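/- Let f : ℍ → ℂ be holomorphic. The following are equivalent: (1) f is bounded on strips and f(·+ih) ∈ AP(ℝ) for every h > 0; (2) f is bounded on strips and f(·+ih) ∈ AP(ℝ) for some h > 0; (3) f ∈ AP(ℍ). In this case, ℰf(λ) = lim_{T→∞} (1/2T) ∫_{−T+iy}^{T+iy} f(z) e^{−2πiλz} dz exists for every λ ∈ ℝ and y > 0, is independent of y, is nonzero for at most countably many λ, and Σ_{λ∈ℝ} |ℰf(λ)|² e^{−4πyλ} = ℰ(|f(·+iy)|²) for every y > 0. -/

import Mathlib

open MeasureTheory Complex Filter Topology Set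
open scoped ENNReal

noncomputable section

/-- The open upper half-plane, as a subset of `ℂ`. -/
def UHP : Set ℂ := {z : ℂ | 0 < z.im}

/-- A relatively dense subset of `ℝ`. -/
def RelDense (τ : Set ℝ) : Prop := ∃ l > (0:ℝ), ∀ x : ℝ, ∃ t ∈ τ, x < t ∧ t < x + l

/-- Bohr almost periodic continuous functions on `ℝ`. -/
def APR (f : ℝ → ℂ) : Prop :=
  Continuous f ∧ ∀ ε > (0:ℝ), RelDense {t : ℝ | ∀ x : ℝ, ‖f x - f (x + t)‖ ≤ ε}

/-- Holomorphic almost periodic functions on the upper half-plane. -/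
def APH (f : ℂ → ℂ) : Prop :=
  DifferentiableOn ℂ f UHP ∧
  ∀ α β ε : ℝ, 0 < α → α < β → 0 < ε →
    ∃ τ : Set ℝ, RelDense τ ∧
      ∀ t ∈ τ, ∀ z : ℂ, α < z.im → z.im < β → ‖f z - f (z + (t : ℂ))‖ ≤ ε

/-- `HasMeanAt f y lam c` : the mean `(1/2T)∫_{-T+iy}^{T+iy} f(z) e^{-2πiλz} dz` tends to `c`. -/
def HasMeanAt (f : ℂ → ℂ) (y lam : ℝ) (c : ℂ) : Prop :=
  Tendsto (fun T : ℝ => (1 / (2 * (T : ℂ))) *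
      ∫ x in (-T)..T, f ((x : ℂ) + (y : ℂ) * Complex.I) *
        Complex.exp (-(2 * (Real.pi : ℂ) * Complex.I * (lam : ℂ) * ((x : ℂ) + (y : ℂ) * Complex.I))))
    atTop (𝓝 c)

/-- `HasMeanR f lam c` : the Bohr mean `(1/2T)∫_{-T}^{T} f(x) e^{-2πiλx} dx` tends to `c`. -/
def HasMeanR (f : ℝ → ℂ) (lam : ℝ) (c : ℂ) : Prop :=
  Tendsto (fun T : ℝ => (1 / (2 * (T : ℂ))) *
      ∫ x in (-T)..T, f x *
        Complex.exp (-(2 * (Real.pi : ℂ) * Complex.I * (lam : ℂ) * (x : ℂ))))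
    atTop (𝓝 c)

/-- The spectrum of a function on the upper half-plane: frequencies where the mean is not `0`. -/
def specH (f : ℂ → ℂ) : Set ℝ := {lam : ℝ | ∃ y > (0:ℝ), ¬ HasMeanAt f y lam 0}

/-- A locally finite subset of `ℝ`. -/
def LocFinSet (S : Set ℝ) : Prop := ∀ a b : ℝ, (S ∩ Set.Ioo a b).Finite

/-- A uniformly discrete subset of `ℝ`. -/
def UnifDiscrete (S : Set ℝ) : Prop :=
  ∃ d > (0:ℝ), ∀ x ∈ S, ∀ y ∈ S, x ≠ y → d ≤ |x - y|

/-- Locally summable coefficient functions. -/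
def LocSummable (a : ℝ → ℂ) : Prop :=
  (Function.support a).Countable ∧
  ∀ T > (0:ℝ), Summable (Set.indicator (Set.Icc (-T) T) fun l => ‖a l‖)

/-- Exponential growth of a coefficient function. -/
def ExpGrowth (a : ℝ → ℂ) : Prop :=
  ∃ c > (0:ℝ), Summable fun lam : ℝ => ‖a lam‖ * Real.exp (-c * |lam|)

/-- `a(-λ) = conj (a(λ))`. -/
def Antipodal (a : ℝ → ℂ) : Prop := ∀ lam : ℝ, a (-lam) = (starRingEnd ℂ) (a lam)

/-- The Fourier transform `φ̂(ξ) = ∫ φ(x) e^{-2πixξ} dx`. -/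
def FT (φ : ℝ → ℂ) (ξ : ℝ) : ℂ :=
  ∫ x : ℝ, φ x * Complex.exp (-(2 * (Real.pi : ℂ) * Complex.I * (x : ℂ) * (ξ : ℂ)))

/-- A complex-valued measure on `ℝ`, encoded by its total variation `ν` together with a
unimodular density `w`, so that `dμ = w dν` and `|μ| = ν`. -/
structure CMeasure where
  ν : Measure ℝ
  w : ℝ → ℂ
  meas : Measurable w
  unit : ∀ᵐ t ∂ν, ‖w t‖ = 1

/-- Integration against a complex measure. -/
def CMeasure.integral (μ : CMeasure) (φ : ℝ → ℂ) : ℂ := ∫ t, φ t * μ.w t ∂μ.ν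

/-- Strongly tempered: every Schwartz function is `|μ|`-integrable. -/
def CMeasure.IsStronglyTempered (μ : CMeasure) : Prop :=
  ∀ φ : SchwartzMap ℝ ℂ, Integrable (fun t => φ t) μ.ν

/-- Real-valued complex measure. -/
def CMeasure.RealValued (μ : CMeasure) : Prop := ∀ᵐ t ∂μ.ν, (μ.w t).im = 0

/-- Nonnegative complex measure. -/
def CMeasure.Nonneg (μ : CMeasure) : Prop := ∀ᵐ t ∂μ.ν, μ.w t = 1

/-- `deg(μ) ≤ n` : `∫ (1+t²)^{-n/2} d|μ| < ∞`. -/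
def CMeasure.DegLE (μ : CMeasure) (n : ℕ) : Prop :=
  Integrable (fun t : ℝ => (1 + t ^ 2) ^ (-(n : ℝ) / 2)) μ.ν

/-- The mass `μ({x})` of an atom. -/
def CMeasure.atom (μ : CMeasure) (x : ℝ) : ℂ := ∫ t in {x}, μ.w t ∂μ.ν

/-- The (closed) support of a measure on `ℝ`. -/
def measSupport (ν : Measure ℝ) : Set ℝ := {x : ℝ | ∀ U ∈ 𝓝 x, ν U ≠ 0}

/-- `(μ, a)` is a Fourier summation pair. -/
def IsFSPair (μ : CMeasure) (a : ℝ → ℂ) : Prop :=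
  μ.IsStronglyTempered ∧ LocSummable a ∧
    ∀ φ : ℝ → ℂ, ContDiff ℝ (⊤ : ℕ∞) φ → HasCompactSupport φ →
      μ.integral (FT φ) = ∑' lam : ℝ, a lam * φ lam

/-- Trigonometric polynomials. -/
def IsTrigPoly (f : ℂ → ℂ) : Prop :=
  ∃ (N : ℕ) (p : Fin N → ℂ) (θ : Fin N → ℝ),
    ∀ z : ℂ, f z = ∑ n, p n * Complex.exp (2 * (Real.pi : ℂ) * Complex.I * (θ n : ℂ) * z)

/-- Functions of bounded type on the upper half-plane. -/
def BoundedType (g : ℂ → ℂ) : Prop :=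
  ∃ P Q : ℂ → ℂ, DifferentiableOn ℂ P UHP ∧ DifferentiableOn ℂ Q UHP ∧
    (∃ C : ℝ, ∀ z ∈ UHP, ‖P z‖ ≤ C) ∧ (∃ C : ℝ, ∀ z ∈ UHP, ‖Q z‖ ≤ C) ∧
    (∀ z ∈ UHP, Q z ≠ 0) ∧ ∀ z ∈ UHP, g z = P z / Q z

/-- Mean type `ϑ(g) = limsup_{y→∞} log|g(iy)|/y`. -/
def MeanType (g : ℂ → ℂ) : ℝ :=
  Filter.limsup (fun y : ℝ => Real.log ‖g ((y : ℂ) * Complex.I)‖ / y) atTop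

/-- `E*(z) = conj (E (conj z))`. -/
def fstar (E : ℂ → ℂ) : ℂ → ℂ := fun z => (starRingEnd ℂ) (E ((starRingEnd ℂ) z))

/-- Hermite–Biehler class: entire with `|E*(z)| < |E(z)|` on the upper half-plane. -/
def HB (E : ℂ → ℂ) : Prop := Differentiable ℂ E ∧ ∀ z ∈ UHP, ‖fstar E z‖ < ‖E z‖

/-- `A = (E* + E)/2`. -/
def HBA (E : ℂ → ℂ) : ℂ → ℂ := fun z => (fstar E z + E z) / 2

/-- `B = (E* - E)/(2i)`. -/
def HBB (E : ℂ → ℂ) : ℂ → ℂ := fun z => (fstar E z - E z) / (2 * Complex.I)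

/-- `φ` is a phase function for `E`, with derivative `φd > 0`. -/
def IsPhaseFor (φ φd : ℝ → ℝ) (E : ℂ → ℂ) : Prop :=
  (∀ x : ℝ, HasDerivAt φ (φd x) x) ∧ (∀ x : ℝ, 0 < φd x) ∧
    ∀ x : ℝ, (Complex.exp (Complex.I * (φ x : ℂ)) * E (x : ℂ)).im = 0

/-- The points where `φ ≡ 0 (mod π)`. -/
def phaseZeros (φ : ℝ → ℝ) : Set ℝ := {γ : ℝ | ∃ k : ℤ, φ γ = k * Real.pi}

/-- The nonnegative measure `2π Σ_{φ(γ)≡0 (mod π)} (1/φ'(γ)) δ_γ`. -/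
def phaseMeasure (φ φd : ℝ → ℝ) : Measure ℝ :=
  Measure.sum fun γ : phaseZeros φ =>
    (ENNReal.ofReal (2 * Real.pi / φd (γ : ℝ))) • Measure.dirac (γ : ℝ)

/-- `μ` is an `ℕ`-valued nonnegative measure. -/
def CMeasure.NValued (μ : CMeasure) : Prop :=
  μ.Nonneg ∧ ∃ (Λ : Set ℝ) (m : ℝ → ℕ), LocFinSet Λ ∧ (∀ γ ∈ Λ, 0 < m γ) ∧
    μ.ν = Measure.sum fun γ : Λ => (m (γ : ℝ) : ℝ≥0∞) • Measure.dirac (γ : ℝ)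

/-- Bounded on every horizontal substrip of the upper half-plane. -/
def BddOnStrips (f : ℂ → ℂ) : Prop :=
  ∀ ε > (0:ℝ), ∃ C : ℝ, ∀ z : ℂ, ε < z.im → z.im < 1/ε → ‖f z‖ ≤ C

/-- The Fejér-type partial sums in formula (eq:fdef). -/
def fdefSum (a : ℝ → ℂ) (T : ℝ) (z : ℂ) : ℂ :=
  a 0 / 2 + ∑' lam : ℝ,
    Set.indicator (Set.Ioo (0 : ℝ) T)
      (fun l => a l * (1 - (l : ℂ) / (T : ℂ)) *
        Complex.exp (2 * (Real.pi : ℂ) * Complex.I * (l : ℂ) * z)) lam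


/-- Two-constants estimate on a horizontal strip, with a small bound on an inner line. -/
lemma exists_delta_three_lines {p α h β q C ε : ℝ} (hp : p < α) (hα : α ≤ h) (hβ : h ≤ β)
    (hq : β < q) (hε : 0 < ε) :
    ∃ δ > (0:ℝ), ∀ g : ℂ → ℂ, DifferentiableOn ℂ g {z | z.im ∈ Icc p q} →
      (∀ z : ℂ, z.im ∈ Icc p q → ‖g z‖ ≤ C) → (∀ z : ℂ, z.im = h → ‖g z‖ ≤ δ) →
      ∀ z : ℂ, z.im ∈ Icc α β → ‖g z‖ ≤ ε := by
  set K := max C 1 with hK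
  have hK1 : 1 ≤ K := le_max_right _ _
  have hph : 0 < h - p := by linarith
  have hqh : 0 < q - h := by linarith
  set σ := min ((α - p) / (h - p)) ((q - β) / (q - h)) with hσ
  have hσ0 : 0 < σ := lt_min (div_pos (by linarith) hph) (div_pos (by linarith) hqh)
  refine ⟨min 1 ((ε / K) ^ (1 / σ)), by positivity, fun g hg hgC hgδ z hz => ?_⟩
  set δ := min 1 ((ε / K) ^ (1 / σ)) with hδ
  have hδ0 : 0 < δ := by positivity
  have hδ1 : δ ≤ 1 := min_le_left _ _
  have hδσ : K * δ ^ σ ≤ ε := by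
    have : δ ^ σ ≤ ((ε / K) ^ (1 / σ)) ^ σ :=
      Real.rpow_le_rpow hδ0.le (min_le_right _ _) hσ0.le
    rw [← Real.rpow_mul (by positivity), one_div_mul_cancel hσ0.ne', Real.rpow_one] at this
    calc K * δ ^ σ ≤ K * (ε / K) := by gcongr
      _ = ε := by field_simp
  have hmain : ∀ s t : ℝ, 0 ≤ s → s ≤ 1 → σ ≤ t → K ^ s * δ ^ t ≤ ε := by
    intro s t hs hs1 ht
    refine le_trans ?_ hδσ
    have h1 : K ^ s ≤ K := by
      simpa using Real.rpow_le_rpow_of_exponent_le hK1 hs1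
    have h2 : δ ^ t ≤ δ ^ σ := Real.rpow_le_rpow_of_exponent_ge hδ0 hδ1 ht
    gcongr
  have hgK : ∀ z : ℂ, z.im ∈ Icc p q → ‖g z‖ ≤ K := fun z hz => (hgC z hz).trans (le_max_left _ _)
  set F : ℂ → ℂ := fun w => g (I * w) with hF
  have him : ∀ w : ℂ, (I * w).im = w.re := fun w => by simp
  have hFd : DifferentiableOn ℂ F (re ⁻¹' Icc p q) := by
    refine hg.comp (by fun_prop) fun w hw => ?_
    simpa using hw
  have hdc : ∀ l u : ℝ, l < u → p ≤ l → u ≤ q →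
      DiffContOnCl ℂ F (HadamardThreeLines.verticalStrip l u) := by
    intro l u hlu hl hu
    refine DifferentiableOn.diffContOnCl (hFd.mono ?_)
    rw [HadamardThreeLines.verticalStrip]
    refine (closure_minimal (preimage_mono Ioo_subset_Icc_self)
      (isClosed_Icc.preimage continuous_re)).trans (preimage_mono (Icc_subset_Icc hl hu))
  have hbd : ∀ l u : ℝ, p ≤ l → u ≤ q →
      BddAbove ((norm ∘ F) '' HadamardThreeLines.verticalClosedStrip l u) := by
    rintro l u hl hu
    refine ⟨K, ?_⟩
    rintro _ ⟨w, hw, rfl⟩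
    refine hgK _ ?_
    rw [him]
    exact Icc_subset_Icc hl hu hw
  have hzF : g z = F (-I * z) := by
    simp only [hF]; congr 1; rw [← mul_assoc]; simp
  have hre : (-I * z).re = z.im := by simp
  have hFδ : ∀ w ∈ re ⁻¹' {h}, ‖F w‖ ≤ δ := fun w hw => hgδ _ (by simpa using hw)
  rw [hzF]
  rcases le_total z.im h with hzh | hzh
  · have := HadamardThreeLines.norm_le_interp_of_mem_verticalClosedStrip' (f := F) (z := -I * z)
      (a := K) (b := δ) (l := p) (u := h) (by linarith)
      (by simp only [HadamardThreeLines.verticalClosedStrip, mem_preimage, hre]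
          exact ⟨by linarith [hz.1], hzh⟩)
      (hdc p h (by linarith) le_rfl (by linarith)) (hbd p h le_rfl (by linarith))
      (fun w hw => hgK _ (by rw [him]; rw [show w.re = p from hw]; exact ⟨le_rfl, by linarith⟩))
      hFδ
    rw [hre] at this
    refine this.trans (hmain _ _ ?_ ?_ ?_)
    · rw [sub_nonneg, div_le_one hph]; linarith
    · rw [sub_le_self_iff]; exact div_nonneg (by linarith [hz.1]) hph.le
    · refine (min_le_left _ _).trans ?_
      gcongr
      exact hz.1
  · have := HadamardThreeLines.norm_le_interp_of_mem_verticalClosedStrip' (f := F) (z := -I * z)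
      (a := δ) (b := K) (l := h) (u := q) (by linarith)
      (by simp only [HadamardThreeLines.verticalClosedStrip, mem_preimage, hre]
          exact ⟨hzh, by linarith [hz.2]⟩)
      (hdc h q (by linarith) (by linarith) le_rfl) (hbd h q (by linarith) le_rfl)
      hFδ
      (fun w hw => hgK _ (by rw [him]; rw [show w.re = q from hw]; exact ⟨by linarith, le_rfl⟩))
    rw [hre] at this
    refine this.trans ?_
    rw [mul_comm]
    refine hmain _ _ ?_ ?_ ?_
    · exact div_nonneg (by linarith [hz.1]) hqh.le
    · rw [div_le_one hqh]; linarith [hz.2]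
    · refine (min_le_right _ _).trans ?_
      rw [one_sub_div hqh.ne']
      exact div_le_div_of_nonneg_right (by linarith [hz.2]) hqh.le

lemma BddOnStrips.exists_bound {f : ℂ → ℂ} (hf : BddOnStrips f) {p q : ℝ} (hp : 0 < p) :
    ∃ C : ℝ, ∀ z : ℂ, z.im ∈ Icc p q → ‖f z‖ ≤ C := by
  set ε := min (p / 2) (1 / (|q| + 1)) with hε
  have h0 : 0 < ε := by positivity
  obtain ⟨C, hC⟩ := hf ε h0
  refine ⟨C, fun z hz => hC z ?_ ?_⟩
  · have := min_le_left (p / 2) (1 / (|q| + 1)); linarith [hz.1]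
  · have h1 : ε ≤ 1 / (|q| + 1) := min_le_right _ _
    have : |q| + 1 ≤ 1 / ε := by
      rw [le_one_div (by positivity) h0]; exact h1
    linarith [hz.2, le_abs_self q]

lemma aph_of_apr_line {f : ℂ → ℂ} (hol : DifferentiableOn ℂ f UHP) (hb : BddOnStrips f)
    {h : ℝ} (hh : 0 < h) (hf : APR fun x : ℝ => f ((x : ℂ) + (h : ℂ) * Complex.I)) : APH f := by
  refine ⟨hol, fun α β ε hα hαβ hε => ?_⟩
  obtain ⟨C, hC⟩ := hb.exists_bound (p := min α h / 2) (q := max β h + 1) (by positivity)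
  have hm : 0 < min α h := lt_min hα hh
  obtain ⟨δ, hδ, H⟩ := exists_delta_three_lines (p := min α h / 2) (α := min α h) (h := h)
    (β := max β h) (q := max β h + 1) (C := C + C) (ε := ε) (by linarith) (min_le_right _ _)
    (le_max_right _ _) (by linarith) hε
  refine ⟨_, hf.2 δ hδ, fun t ht z hz1 hz2 => ?_⟩
  refine H (fun z => f z - f (z + (t : ℂ))) ?_ ?_ ?_ z
    ⟨(min_le_left _ _).trans hz1.le, hz2.le.trans (le_max_left _ _)⟩
  · have h1 : {z : ℂ | z.im ∈ Icc (min α h / 2) (max β h + 1)} ⊆ UHP := fun z hz => by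
      have := hz.1
      show 0 < z.im
      linarith
    refine (hol.mono h1).sub ((hol.mono h1).comp (f := fun z => z + (t : ℂ)) (by fun_prop)
      fun z hz => ?_)
    simpa using hz
  · intro z hz
    refine (norm_sub_le _ _).trans (add_le_add (hC z hz) (hC _ (by simpa using hz)))
  · intro z hz
    have := ht z.re
    have e1 : ((z.re : ℂ) + (h : ℂ) * I) = z := by rw [← hz]; exact re_add_im z
    have e2 : (((z.re + t : ℝ) : ℂ) + (h : ℂ) * I) = z + t := by
      rw [← e1]; push_cast; simp; ring
    simpa only [e1, e2] using this

lemma exists_mem_add_mem_Icc {τ : Set ℝ} (h : RelDense τ) :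
    ∃ l > (0:ℝ), ∀ x : ℝ, ∃ t ∈ τ, x + t ∈ Icc 0 l := by
  obtain ⟨l, hl, H⟩ := h
  refine ⟨l, hl, fun x => ?_⟩
  obtain ⟨t, ht, h1, h2⟩ := H (-x)
  exact ⟨t, ht, by linarith, by linarith⟩

lemma continuous_line {f : ℂ → ℂ} (hol : DifferentiableOn ℂ f UHP) {h : ℝ} (hh : 0 < h) :
    Continuous fun x : ℝ => f ((x : ℂ) + (h : ℂ) * Complex.I) :=
  hol.continuousOn.comp_continuous (by fun_prop) fun x => by simpa [UHP] using hh

lemma APH.apr_line {f : ℂ → ℂ} (hf : APH f) {h : ℝ} (hh : 0 < h) :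
    APR fun x : ℝ => f ((x : ℂ) + (h : ℂ) * Complex.I) := by
  refine ⟨continuous_line hf.1 hh, fun ε hε => ?_⟩
  obtain ⟨τ, ⟨l, hl, hτ⟩, H⟩ := hf.2 (h / 2) (2 * h) ε (by linarith) (by linarith) hε
  refine ⟨l, hl, fun x => ?_⟩
  obtain ⟨t, ht, h1⟩ := hτ x
  refine ⟨t, fun y => ?_, h1⟩
  have := H t ht ((y : ℂ) + (h : ℂ) * I) (by simp; linarith) (by simp; linarith)
  convert this using 4
  push_cast; ring

lemma APH.bddOnStrips {f : ℂ → ℂ} (hf : APH f) : BddOnStrips f := by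
  intro ε hε
  by_cases hlt : ε < 1 / ε
  · obtain ⟨τ, hτ, H⟩ := hf.2 ε (1 / ε) 1 hε hlt one_pos
    obtain ⟨l, hl, hτ⟩ := exists_mem_add_mem_Icc hτ
    have hK : IsCompact (Icc 0 l ×ℂ Icc ε (1 / ε)) := isCompact_Icc.reProdIm isCompact_Icc
    obtain ⟨C, hC⟩ := hK.exists_bound_of_continuousOn (f := f) (hf.1.continuousOn.mono fun z hz =>
      lt_of_lt_of_le hε (mem_reProdIm.1 hz).2.1)
    refine ⟨C + 1, fun z h1 h2 => ?_⟩
    obtain ⟨t, ht, hzt⟩ := hτ z.re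
    have h3 := H t ht z h1 h2
    have h4 := hC (z + t) (mem_reProdIm.2 ⟨by simpa using hzt, by simpa using ⟨h1.le, by simpa using h2.le⟩⟩)
    have h5 : ‖f z‖ ≤ ‖f z - f (z + t)‖ + ‖f (z + t)‖ := by
      simpa using norm_add_le (f z - f (z + t)) (f (z + t))
    linarith
  · exact ⟨0, fun z h1 h2 => absurd (h1.trans h2) hlt⟩

/-- Bochner's form of almost periodicity: a bounded continuous function whose translates form a
totally bounded family for the supremum norm. -/
structure TranslatesTotallyBounded (g : ℝ → ℂ) : Prop where
  cont : Continuous g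
  bdd : ∃ C : ℝ, ∀ x, ‖g x‖ ≤ C
  net : ∀ ε > (0:ℝ), ∃ F : Finset ℝ, ∀ t, ∃ s ∈ F, ∀ x, ‖g (x + t) - g (x + s)‖ ≤ ε

lemma exists_uniform_delta {g : ℝ → ℂ} (hg : Continuous g) (K : Set ℝ) (hK : IsCompact K) {ε : ℝ}
    (hε : 0 < ε) :
    ∃ δ > (0:ℝ), ∀ x ∈ K, ∀ y ∈ K, |x - y| < δ → ‖g x - g y‖ < ε := by
  obtain ⟨δ, hδ, h⟩ := Metric.uniformContinuousOn_iff.1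
    (hK.uniformContinuousOn_of_continuous hg.continuousOn) ε hε
  exact ⟨δ, hδ, fun x hx y hy hxy => by
    simpa [dist_eq_norm] using h x hx y hy (by simpa [Real.dist_eq] using hxy)⟩

lemma APR.uniform_delta {g : ℝ → ℂ} (hg : APR g) {ε : ℝ} (hε : 0 < ε) :
    ∃ δ > (0:ℝ), ∀ x y : ℝ, |x - y| < δ → ‖g x - g y‖ ≤ ε := by
  obtain ⟨l, hl, hτ⟩ := exists_mem_add_mem_Icc (hg.2 (ε / 3) (by linarith))
  obtain ⟨δ, hδ, h⟩ := exists_uniform_delta hg.1 (Icc (-1) (l + 1)) isCompact_Icc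
    (show 0 < ε / 3 by linarith)
  refine ⟨min δ 1, by positivity, fun x y hxy => ?_⟩
  obtain ⟨t, ht, h1⟩ := hτ x
  have hxy1 := hxy.trans_le (min_le_right _ _)
  rw [abs_lt] at hxy1
  have h2 := h (x + t) ⟨by linarith [h1.1], by linarith [h1.2]⟩ (y + t)
    ⟨by linarith [h1.1], by linarith [h1.2]⟩ (by
      rw [add_sub_add_right_eq_sub]; exact hxy.trans_le (min_le_left _ _))
  have h3 := ht x
  have h4 := ht y
  calc ‖g x - g y‖ = ‖(g x - g (x + t)) + (g (x + t) - g (y + t)) - (g y - g (y + t))‖ := by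
        congr 1; ring
    _ ≤ ‖g x - g (x + t)‖ + ‖g (x + t) - g (y + t)‖ + ‖g y - g (y + t)‖ :=
        (norm_sub_le _ _).trans (by gcongr; exact norm_add_le _ _)
    _ ≤ ε := by linarith

lemma APR.translatesTotallyBounded {g : ℝ → ℂ} (hg : APR g) : TranslatesTotallyBounded g := by
  refine ⟨hg.1, ?_, fun ε hε => ?_⟩
  · obtain ⟨l, hl, hτ⟩ := exists_mem_add_mem_Icc (hg.2 1 one_pos)
    obtain ⟨C, hC⟩ := (isCompact_Icc (a := (0:ℝ)) (b := l)).exists_bound_of_continuousOn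
      hg.1.continuousOn
    refine ⟨1 + C, fun x => ?_⟩
    obtain ⟨t, ht, h1⟩ := hτ x
    calc ‖g x‖ = ‖(g x - g (x + t)) + g (x + t)‖ := by congr 1; ring
      _ ≤ 1 + C := (norm_add_le _ _).trans (add_le_add (ht x) (hC _ h1))
  · obtain ⟨l, hl, hτ⟩ := exists_mem_add_mem_Icc (hg.2 (ε / 2) (by linarith))
    obtain ⟨δ, hδ, h⟩ := hg.uniform_delta (show 0 < ε / 2 by linarith)
    obtain ⟨F, -, hF⟩ := Metric.totallyBounded_iff.1
      (isCompact_Icc (a := (0:ℝ)) (b := l)).totallyBounded δ hδ |>.imp fun F hF =>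
        (⟨trivial, hF⟩ : True ∧ _)
    refine ⟨hF.1.toFinset, fun t => ?_⟩
    obtain ⟨u, hu, h1⟩ := hτ t
    obtain ⟨s, hs, h2⟩ := mem_iUnion₂.1 (hF.2 h1)
    refine ⟨s, hF.1.mem_toFinset.2 hs, fun x => ?_⟩
    have h3 := hu (x + t)
    have h4 := h (x + t + u) (x + s) (by
      rw [Metric.mem_ball, Real.dist_eq] at h2
      convert h2 using 2; ring)
    calc ‖g (x + t) - g (x + s)‖
        = ‖(g (x + t) - g (x + t + u)) + (g (x + t + u) - g (x + s))‖ := by congr 1; ring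
      _ ≤ ε := (norm_add_le _ _).trans (by linarith)

namespace TranslatesTotallyBounded

variable {g g₁ g₂ : ℝ → ℂ}

lemma conj (hg : TranslatesTotallyBounded g) :
    TranslatesTotallyBounded fun x => (starRingEnd ℂ) (g x) := by
  refine ⟨continuous_conj.comp hg.cont, by simpa using hg.bdd, fun ε hε => ?_⟩
  obtain ⟨F, hF⟩ := hg.net ε hε
  refine ⟨F, fun t => ?_⟩
  obtain ⟨s, hs, h⟩ := hF t
  exact ⟨s, hs, fun x => by rw [← map_sub, RCLike.norm_conj]; exact h x⟩

lemma translate (hg : TranslatesTotallyBounded g) (a : ℝ) :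
    TranslatesTotallyBounded fun x => g (x + a) := by
  obtain ⟨C, hC⟩ := hg.bdd
  refine ⟨hg.cont.comp (by fun_prop), ⟨C, fun x => hC _⟩, fun ε hε => ?_⟩
  obtain ⟨F, hF⟩ := hg.net ε hε
  refine ⟨F, fun t => ?_⟩
  obtain ⟨s, hs, h⟩ := hF t
  exact ⟨s, hs, fun x => by simpa only [add_right_comm] using h (x + a)⟩

/-- Total boundedness of translates can be checked through finitely many functions controlling
the differences. -/
lemma exists_common_net (h₁ : TranslatesTotallyBounded g₁) (h₂ : TranslatesTotallyBounded g₂)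
    {ε : ℝ} (hε : 0 < ε) :
    ∃ F : Finset ℝ, ∀ t, ∃ s ∈ F, (∀ x, ‖g₁ (x + t) - g₁ (x + s)‖ ≤ ε) ∧
      ∀ x, ‖g₂ (x + t) - g₂ (x + s)‖ ≤ ε := by
  classical
  obtain ⟨F₁, hF₁⟩ := h₁.net (ε / 2) (by linarith)
  obtain ⟨F₂, hF₂⟩ := h₂.net (ε / 2) (by linarith)
  let P : ℝ × ℝ → ℝ → Prop := fun p t =>
    (∀ x, ‖g₁ (x + t) - g₁ (x + p.1)‖ ≤ ε / 2) ∧ ∀ x, ‖g₂ (x + t) - g₂ (x + p.2)‖ ≤ ε / 2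
  let r : ℝ × ℝ → ℝ := fun p => if h : ∃ t, P p t then h.choose else 0
  refine ⟨(F₁ ×ˢ F₂).image r, fun t => ?_⟩
  obtain ⟨s₁, hs₁, k₁⟩ := hF₁ t
  obtain ⟨s₂, hs₂, k₂⟩ := hF₂ t
  have hP : ∃ t, P (s₁, s₂) t := ⟨t, k₁, k₂⟩
  have hr : P (s₁, s₂) (r (s₁, s₂)) := by
    simp only [r, dif_pos hP]; exact hP.choose_spec
  refine ⟨r (s₁, s₂), Finset.mem_image_of_mem _ (Finset.mk_mem_product hs₁ hs₂),
    fun x => ?_, fun x => ?_⟩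
  · have := norm_sub_le_norm_sub_add_norm_sub (g₁ (x + t)) (g₁ (x + s₁)) (g₁ (x + r (s₁, s₂)))
    have e := hr.1 x
    rw [norm_sub_rev] at e
    linarith [k₁ x]
  · have := norm_sub_le_norm_sub_add_norm_sub (g₂ (x + t)) (g₂ (x + s₂)) (g₂ (x + r (s₁, s₂)))
    have e := hr.2 x
    rw [norm_sub_rev] at e
    linarith [k₂ x]

lemma mul (h₁ : TranslatesTotallyBounded g₁) (h₂ : TranslatesTotallyBounded g₂) :
    TranslatesTotallyBounded fun x => g₁ x * g₂ x := by
  obtain ⟨C₁, hC₁⟩ := h₁.bdd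
  obtain ⟨C₂, hC₂⟩ := h₂.bdd
  have hC₁0 : 0 ≤ C₁ := (norm_nonneg _).trans (hC₁ 0)
  have hC₂0 : 0 ≤ C₂ := (norm_nonneg _).trans (hC₂ 0)
  refine ⟨h₁.cont.mul h₂.cont, ⟨C₁ * C₂, fun x => ?_⟩, fun ε hε => ?_⟩
  · rw [norm_mul]; exact mul_le_mul (hC₁ x) (hC₂ x) (norm_nonneg _) hC₁0
  · obtain ⟨F, hF⟩ := exists_common_net h₁ h₂ (show 0 < ε / (C₁ + C₂ + 1) by positivity)
    refine ⟨F, fun t => ?_⟩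
    obtain ⟨s, hs, k₁, k₂⟩ := hF t
    refine ⟨s, hs, fun x => ?_⟩
    calc ‖g₁ (x + t) * g₂ (x + t) - g₁ (x + s) * g₂ (x + s)‖
        = ‖(g₁ (x + t) - g₁ (x + s)) * g₂ (x + t) + g₁ (x + s) * (g₂ (x + t) - g₂ (x + s))‖ := by
          congr 1; ring
      _ ≤ ε / (C₁ + C₂ + 1) * C₂ + C₁ * (ε / (C₁ + C₂ + 1)) := by
          refine (norm_add_le _ _).trans ?_
          rw [norm_mul, norm_mul]
          exact add_le_add (mul_le_mul (k₁ x) (hC₂ _) (norm_nonneg _) (by positivity))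
            (mul_le_mul (hC₁ _) (k₂ x) (norm_nonneg _) hC₁0)
      _ = ε * ((C₁ + C₂) / (C₁ + C₂ + 1)) := by ring
      _ ≤ ε * 1 := by
          gcongr
          rw [div_le_one (by positivity)]; linarith
      _ = ε := mul_one _

end TranslatesTotallyBounded

lemma apr_cexp (w : ℝ) : APR fun x : ℝ => cexp (-(w * x * I)) := by
  refine ⟨by fun_prop, fun ε hε => ?_⟩
  have key : ∀ t : ℝ, cexp (-(w * t * I)) = 1 → t ∈ {t : ℝ | ∀ x : ℝ,
      ‖cexp (-(w * x * I)) - cexp (-(w * (x + t : ℝ) * I))‖ ≤ ε} := fun t ht x => by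
    have : cexp (-(w * (x + t : ℝ) * I)) = cexp (-(w * x * I)) := by
      rw [show (-(w * (x + t : ℝ) * I) : ℂ) = -(w * x * I) + -(w * t * I) by push_cast; ring,
        Complex.exp_add, ht, mul_one]
    rw [this]; simpa using hε.le
  by_cases hw : w = 0
  · refine ⟨1, one_pos, fun x => ⟨x + 1 / 2, key _ (by simp [hw]), by linarith, by linarith⟩⟩
  · set p := 2 * Real.pi / |w| with hp
    have hp0 : 0 < p := by positivity
    refine ⟨2 * p, by positivity, fun x => ⟨(⌊x / p⌋ + 1) * p, key _ ?_, ?_, ?_⟩⟩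
    · rw [Complex.exp_eq_one_iff]
      have hpc : (p : ℂ) * |w| = 2 * Real.pi := by
        have hw' : ((|w| : ℝ) : ℂ) ≠ 0 := by exact_mod_cast abs_ne_zero.2 hw
        rw [hp]; push_cast; field_simp
      rcases abs_choice w with h | h
      · refine ⟨-(⌊x / p⌋ + 1), ?_⟩
        rw [h] at hpc
        push_cast
        linear_combination (-(⌊x / p⌋ + 1 : ℂ) * I) * hpc
      · refine ⟨⌊x / p⌋ + 1, ?_⟩
        rw [h] at hpc
        push_cast at hpc ⊢
        linear_combination ((⌊x / p⌋ + 1 : ℂ) * I) * hpc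
    · have := Int.lt_floor_add_one (x / p)
      rwa [div_lt_iff₀ hp0] at this
    · have := Int.floor_le (x / p)
      rw [le_div_iff₀ hp0] at this
      linarith

/-- The mean of `g` over the symmetric interval `[-T, T]`. -/
def bohrMean (T : ℝ) (g : ℝ → ℂ) : ℂ := (1 / (2 * (T : ℂ))) * ∫ x in (-T)..T, g x

lemma norm_one_div_two_mul {T : ℝ} (hT : 0 < T) : ‖(1 / (2 * (T : ℂ)))‖ = 1 / (2 * T) := by
  simp [abs_of_pos hT]

lemma norm_bohrMean_le {g : ℝ → ℂ} {T C : ℝ} (hT : 0 < T) (h : ∀ x, ‖g x‖ ≤ C) :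
    ‖bohrMean T g‖ ≤ C := by
  have := intervalIntegral.norm_integral_le_of_norm_le_const (a := -T) (b := T) (f := g) (C := C)
    fun x _ => h x
  rw [bohrMean, norm_mul, norm_one_div_two_mul hT]
  calc 1 / (2 * T) * ‖∫ x in (-T)..T, g x‖ ≤ 1 / (2 * T) * (C * |T - -T|) := by gcongr
    _ = C := by rw [abs_of_pos (by linarith)]; field_simp; ring

lemma bohrMean_sub {g₁ g₂ : ℝ → ℂ} (h₁ : Continuous g₁) (h₂ : Continuous g₂) (T : ℝ) :
    bohrMean T (fun x => g₁ x - g₂ x) = bohrMean T g₁ - bohrMean T g₂ := by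
  rw [bohrMean, intervalIntegral.integral_sub (h₁.intervalIntegrable _ _)
    (h₂.intervalIntegrable _ _), mul_sub]; rfl

lemma bohrMean_const_mul (g : ℝ → ℂ) (c : ℂ) (T : ℝ) :
    bohrMean T (fun x => c * g x) = c * bohrMean T g := by
  rw [bohrMean, intervalIntegral.integral_const_mul, bohrMean]; ring

lemma bohrMean_mul_const (g : ℝ → ℂ) (c : ℂ) (T : ℝ) :
    bohrMean T (fun x => g x * c) = bohrMean T g * c := by
  rw [bohrMean, intervalIntegral.integral_mul_const, bohrMean]; ring

lemma bohrMean_const {T : ℝ} (hT : 0 < T) (c : ℂ) : bohrMean T (fun _ => c) = c := by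
  have hT' : (T : ℂ) ≠ 0 := by exact_mod_cast hT.ne'
  rw [bohrMean, intervalIntegral.integral_const, Complex.real_smul]
  push_cast
  field_simp
  ring

lemma bohrMean_conj (g : ℝ → ℂ) (T : ℝ) :
    bohrMean T (fun x => (starRingEnd ℂ) (g x)) = (starRingEnd ℂ) (bohrMean T g) := by
  simp only [bohrMean, intervalIntegral, integral_conj, map_mul, map_sub]
  congr 1
  simp [Complex.conj_ofNat]

lemma norm_bohrMean_sub_le {g₁ g₂ : ℝ → ℂ} (h₁ : Continuous g₁) (h₂ : Continuous g₂) {T ε : ℝ}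
    (hT : 0 < T) (h : ∀ x, ‖g₁ x - g₂ x‖ ≤ ε) : ‖bohrMean T g₁ - bohrMean T g₂‖ ≤ ε := by
  rw [← bohrMean_sub h₁ h₂]
  exact norm_bohrMean_le hT h

lemma norm_bohrMean_translate_sub_le {g : ℝ → ℂ} (hg : Continuous g) {T C : ℝ} (hT : 0 < T)
    (h : ∀ x, ‖g x‖ ≤ C) (s : ℝ) :
    ‖bohrMean T (fun x => g (x + s)) - bohrMean T g‖ ≤ C * |s| / T := by
  have hi : ∀ a b, IntervalIntegrable g volume a b := fun a b => hg.intervalIntegrable a b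
  have e : (∫ x in (-T)..T, g (x + s)) - ∫ x in (-T)..T, g x
      = (∫ x in T..(T + s), g x) - ∫ x in (-T)..(-T + s), g x := by
    rw [intervalIntegral.integral_comp_add_right]
    have h1 := intervalIntegral.integral_add_adjacent_intervals (hi (-T) (-T + s)) (hi (-T + s) (T + s))
    have h2 := intervalIntegral.integral_add_adjacent_intervals (hi (-T) T) (hi T (T + s))
    rw [← h2] at h1
    linear_combination h1
  have b1 := intervalIntegral.norm_integral_le_of_norm_le_const (a := T) (b := T + s) (f := g)
    (C := C) fun x _ => h x
  have b2 := intervalIntegral.norm_integral_le_of_norm_le_const (a := -T) (b := -T + s) (f := g)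
    (C := C) fun x _ => h x
  rw [add_sub_cancel_left] at b1 b2
  rw [bohrMean, bohrMean, ← mul_sub, e, norm_mul, norm_one_div_two_mul hT]
  calc _ ≤ 1 / (2 * T) * (C * |s| + C * |s|) := by
        gcongr
        exact (norm_sub_le _ _).trans (add_le_add b1 b2)
    _ = C * |s| / T := by field_simp; ring

lemma bohrMean_comm {F : ℝ → ℝ → ℂ} (hF : Continuous (Function.uncurry F)) (S T : ℝ) :
    bohrMean S (fun x => bohrMean T fun t => F x t) =
      bohrMean T (fun t => bohrMean S fun x => F x t) := by
  have : ∫ x in (-S)..S, ∫ t in (-T)..T, F x t = ∫ t in (-T)..T, ∫ x in (-S)..S, F x t := by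
    refine intervalIntegral_intervalIntegral_swap ?_
    refine (hF.continuousOn.integrableOn_compact (isCompact_uIcc.prod isCompact_uIcc)).mono_set
      (prod_mono uIoc_subset_uIcc uIoc_subset_uIcc)
  simp only [bohrMean, intervalIntegral.integral_const_mul]
  rw [this]; ring

namespace TranslatesTotallyBounded

variable {g : ℝ → ℂ}

lemma exists_norm_bohrMean_translate_sub_le (hg : TranslatesTotallyBounded g) {ε : ℝ}
    (hε : 0 < ε) :
    ∃ T₀ > (0:ℝ), ∀ T ≥ T₀, ∀ s, ‖bohrMean T (fun x => g (x + s)) - bohrMean T g‖ ≤ ε := by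
  obtain ⟨C, hC⟩ := hg.bdd
  have hC0 : 0 ≤ C := (norm_nonneg _).trans (hC 0)
  obtain ⟨F, hF⟩ := hg.net (ε / 2) (by linarith)
  set R := ∑ s ∈ F, |s| with hR
  have hR0 : 0 ≤ R := Finset.sum_nonneg fun _ _ => abs_nonneg _
  refine ⟨C * R / (ε / 2) + 1, by positivity, fun T hT s => ?_⟩
  have hT0 : 0 < T := lt_of_lt_of_le (by positivity) hT
  obtain ⟨u, hu, h⟩ := hF s
  have hus : |u| ≤ R := Finset.single_le_sum (f := fun s : ℝ => |s|) (fun _ _ => abs_nonneg _) hu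
  have h1 : ‖bohrMean T (fun x => g (x + s)) - bohrMean T (fun x => g (x + u))‖ ≤ ε / 2 :=
    norm_bohrMean_sub_le (hg.cont.comp (by fun_prop)) (hg.cont.comp (by fun_prop)) hT0 h
  have h2 := norm_bohrMean_translate_sub_le hg.cont hT0 hC u
  have h3 : C * |u| / T ≤ ε / 2 := by
    rw [div_le_iff₀ hT0]
    have h4 : C * R / (ε / 2) ≤ T := by linarith
    rw [div_le_iff₀ (by linarith)] at h4
    have : C * |u| ≤ C * R := by gcongr
    linarith
  calc _ ≤ _ := norm_sub_le_norm_sub_add_norm_sub _ (bohrMean T fun x => g (x + u)) _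
    _ ≤ ε := by linarith

/-- The means of an almost periodic function converge, uniformly over translates. -/
lemma exists_bohrMean (hg : TranslatesTotallyBounded g) :
    ∃ c : ℂ, ∀ ε > (0:ℝ), ∃ T₀ > (0:ℝ), ∀ T ≥ T₀, ∀ s,
      ‖bohrMean T (fun x => g (x + s)) - c‖ ≤ ε := by
  have hcomm : ∀ S T : ℝ, bohrMean S (fun s => bohrMean T fun x => g (x + s)) =
      bohrMean T (fun s => bohrMean S fun x => g (x + s)) := fun S T => by
    rw [bohrMean_comm (F := fun s x => g (x + s)) (hg.cont.comp (by fun_prop))]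
    simp only [add_comm]
  have hcont : ∀ T, Continuous fun s => bohrMean T fun x => g (x + s) := fun T => by
    refine continuous_const.mul ?_
    exact intervalIntegral.continuous_parametric_intervalIntegral_of_continuous'
      (f := fun s x => g (x + s)) (hg.cont.comp (by fun_prop)) _ _
  have hcauchy : ∀ ε > (0:ℝ), ∃ T₀ > (0:ℝ), ∀ T ≥ T₀, ∀ S ≥ T₀,
      ‖bohrMean T g - bohrMean S g‖ ≤ ε := by
    intro ε hε
    obtain ⟨T₀, hT₀, h⟩ := hg.exists_norm_bohrMean_translate_sub_le (show 0 < ε / 2 by linarith)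
    refine ⟨T₀, hT₀, fun T hT S hS => ?_⟩
    have key : ∀ S T, T₀ ≤ S → T₀ ≤ T →
        ‖bohrMean S (fun s => bohrMean T fun x => g (x + s)) - bohrMean T g‖ ≤ ε / 2 := by
      intro S T hS hT
      have hS0 : 0 < S := hT₀.trans_le hS
      conv_lhs => rw [← bohrMean_const hS0 (bohrMean T g)]
      exact norm_bohrMean_sub_le (hcont T) continuous_const hS0 (h T hT)
    have h1 := key S T hS hT
    have h2 := key T S hT hS
    rw [← hcomm] at h2
    rw [norm_sub_rev] at h1
    calc _ ≤ _ := norm_sub_le_norm_sub_add_norm_sub _ _ _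
      _ ≤ ε := by linarith
  have hC : CauchySeq fun T => bohrMean T g := by
    rw [Metric.cauchySeq_iff]
    intro ε hε
    obtain ⟨T₀, -, h⟩ := hcauchy (ε / 2) (by linarith)
    exact ⟨T₀, fun T hT S hS => by rw [dist_eq_norm]; linarith [h T hT S hS]⟩
  obtain ⟨c, hc⟩ := cauchySeq_tendsto_of_complete hC
  refine ⟨c, fun ε hε => ?_⟩
  obtain ⟨T₀, hT₀, h⟩ := hg.exists_norm_bohrMean_translate_sub_le (show 0 < ε / 2 by linarith)
  obtain ⟨T₁, h₁⟩ := Metric.tendsto_atTop.1 hc (ε / 2) (by linarith)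
  refine ⟨max T₀ T₁, lt_max_of_lt_left hT₀, fun T hT s => ?_⟩
  have k₁ := h T ((le_max_left _ _).trans hT) s
  have k₂ := h₁ T ((le_max_right _ _).trans hT)
  rw [dist_eq_norm] at k₂
  calc _ ≤ _ := norm_sub_le_norm_sub_add_norm_sub _ (bohrMean T g) _
    _ ≤ ε := by linarith

/-- The limit of the means over symmetric intervals. -/
def meanValue (hg : TranslatesTotallyBounded g) : ℂ := hg.exists_bohrMean.choose

lemma uniform_bohrMean (hg : TranslatesTotallyBounded g) {ε : ℝ} (hε : 0 < ε) :
    ∃ T₀ > (0:ℝ), ∀ T ≥ T₀, ∀ s, ‖bohrMean T (fun x => g (x + s)) - hg.meanValue‖ ≤ ε :=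
  hg.exists_bohrMean.choose_spec ε hε

lemma tendsto_bohrMean (hg : TranslatesTotallyBounded g) :
    Tendsto (fun T => bohrMean T g) atTop (𝓝 hg.meanValue) := by
  rw [Metric.tendsto_atTop]
  intro ε hε
  obtain ⟨T₀, hT₀, h⟩ := hg.uniform_bohrMean (show 0 < ε / 2 by linarith)
  refine ⟨T₀, fun T hT => ?_⟩
  have := h T hT 0
  simp only [add_zero] at this
  rw [dist_eq_norm]; linarith

end TranslatesTotallyBounded

lemma bohrMean_ofReal (r : ℝ → ℝ) (T : ℝ) :
    bohrMean T (fun x => (r x : ℂ)) = ((1 / (2 * T) * ∫ x in (-T)..T, r x : ℝ) : ℂ) := by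
  rw [bohrMean, intervalIntegral.integral_ofReal]; push_cast; rfl

lemma bohrMean_finset_sum {ι : Type*} (F : Finset ι) {g : ι → ℝ → ℂ}
    (hg : ∀ i ∈ F, Continuous (g i)) (T : ℝ) :
    bohrMean T (fun x => ∑ i ∈ F, g i x) = ∑ i ∈ F, bohrMean T (g i) := by
  rw [bohrMean, intervalIntegral.integral_finsetSum
    fun i hi => (hg i hi).intervalIntegrable _ _, Finset.mul_sum]; rfl

lemma tendsto_bohrMean_translate {g : ℝ → ℂ} (hg : Continuous g) {C : ℝ} (h : ∀ x, ‖g x‖ ≤ C)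
    {c : ℂ} (hc : Tendsto (fun T => bohrMean T g) atTop (𝓝 c)) (s : ℝ) :
    Tendsto (fun T => bohrMean T fun x => g (x + s)) atTop (𝓝 c) := by
  have h0 : Tendsto (fun T => bohrMean T (fun x => g (x + s)) - bohrMean T g) atTop (𝓝 0) := by
    refine squeeze_zero_norm' (a := fun T => C * |s| / T) ?_ (tendsto_const_nhds.div_atTop tendsto_id)
    filter_upwards [eventually_gt_atTop 0] with T hT using
      norm_bohrMean_translate_sub_le hg hT h s
  simpa using h0.add hc

/-- Almost periodic functions with vanishing mean square vanish. -/
lemma TranslatesTotallyBounded.eq_zero_of_tendsto {g : ℝ → ℂ} (hg : TranslatesTotallyBounded g)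
    (h : Tendsto (fun T => bohrMean T fun x => g x * (starRingEnd ℂ) (g x)) atTop (𝓝 0)) (x₀ : ℝ) :
    g x₀ = 0 := by
  by_contra hne
  set ε := ‖g x₀‖ / 2 with hε
  have hε0 : 0 < ε := by positivity
  obtain ⟨F, hF⟩ := hg.net ε hε0
  have hQ := hg.mul hg.conj
  obtain ⟨C, hC⟩ := hQ.bdd
  have hlow : ∀ u : ℝ, ε ^ 2 ≤ ∑ s ∈ F, ‖g (u + (x₀ + s))‖ ^ 2 := fun u => by
    obtain ⟨s, hs, h⟩ := hF (-u)
    have h1 := h (x₀ + u)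
    rw [add_neg_cancel_right] at h1
    have h2 : ε ≤ ‖g (u + (x₀ + s))‖ := by
      rw [show u + (x₀ + s) = x₀ + u + s by ring]
      have := norm_sub_norm_le (g x₀) (g (x₀ + u + s))
      linarith
    calc ε ^ 2 ≤ ‖g (u + (x₀ + s))‖ ^ 2 := by gcongr
      _ ≤ _ := Finset.single_le_sum (f := fun s => ‖g (u + (x₀ + s))‖ ^ 2)
        (fun _ _ => by positivity) hs
  have hlim : Tendsto (fun T => ∑ s ∈ F, bohrMean T fun u =>
      g (u + (x₀ + s)) * (starRingEnd ℂ) (g (u + (x₀ + s)))) atTop (𝓝 0) := by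
    simpa using tendsto_finsetSum F fun s _ => tendsto_bohrMean_translate hQ.cont hC h (x₀ + s)
  have hre := (Complex.continuous_re.tendsto _).comp hlim
  have hle := ge_of_tendsto hre (b := ε ^ 2) ?_
  · simp only [zero_re] at hle
    exact absurd hle (not_le.2 (by positivity))
  filter_upwards [eventually_gt_atTop 0] with T hT
  have hcont := hg.cont
  rw [Function.comp_apply, ← bohrMean_finset_sum F fun s _ =>
    (hQ.translate (x₀ + s)).cont]
  simp only [Complex.mul_conj']
  have e : (fun u => ∑ s ∈ F, ((‖g (u + (x₀ + s))‖ : ℂ)) ^ 2) =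
      fun u => ((∑ s ∈ F, ‖g (u + (x₀ + s))‖ ^ 2 : ℝ) : ℂ) := by
    ext u; push_cast; rfl
  rw [e, bohrMean_ofReal, ofReal_re]
  calc ε ^ 2 = 1 / (2 * T) * ∫ x in (-T)..T, ε ^ 2 := by
        rw [intervalIntegral.integral_const, smul_eq_mul]; field_simp; ring
    _ ≤ _ := by
        gcongr
        refine intervalIntegral.integral_mono_on (by linarith) (by simp) ?_ fun u _ => hlow u
        exact Continuous.intervalIntegrable (by fun_prop) _ _

/-- **Wiener's lemma**: the mean of a characteristic function is the mass of the origin. -/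
lemma tendsto_bohrMean_charFun (ν : Measure ℝ) [IsFiniteMeasure ν] :
    Tendsto (fun T => bohrMean T (charFun ν)) atTop (𝓝 (ν.real {0} : ℝ)) := by
  have h : Tendsto (fun T : ℝ => ∫ x, Real.sinc (T * x) ∂ν) atTop
      (𝓝 (∫ x, ({0} : Set ℝ).indicator (fun _ => (1:ℝ)) x ∂ν)) := by
    refine tendsto_integral_filter_of_dominated_convergence (fun _ => 1) ?_ ?_
      (integrable_const _) ?_
    · exact .of_forall fun T => (Real.continuous_sinc.comp (by fun_prop)).aestronglyMeasurable
    · exact .of_forall fun T => .of_forall fun x => Real.abs_sinc_le_one _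
    · refine .of_forall fun x => ?_
      by_cases hx : x = 0
      · simp [hx]
      · rw [indicator_of_notMem (by simpa using hx)]
        refine squeeze_zero_norm' (a := fun T : ℝ => (|x|⁻¹) / T) ?_
          (tendsto_const_nhds.div_atTop tendsto_id)
        filter_upwards [eventually_gt_atTop 0] with T hT
        rw [Real.sinc_of_ne_zero (by positivity), Real.norm_eq_abs, abs_div, abs_mul, abs_of_pos hT,
          div_le_div_iff₀ (by positivity) hT, ← mul_assoc, mul_comm (|x|⁻¹), mul_assoc,
          inv_mul_cancel₀ (by positivity), mul_one]
        exact mul_le_of_le_one_left hT.le (Real.abs_sin_le_one _)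
  rw [integral_indicator_const _ (measurableSet_singleton _), smul_eq_mul, mul_one] at h
  refine ((Complex.continuous_ofReal.tendsto _).comp h).congr' ?_
  filter_upwards [eventually_gt_atTop 0] with T hT
  have hT' : (T : ℂ) ≠ 0 := by exact_mod_cast hT.ne'
  rw [bohrMean, integral_charFun_Icc hT, Function.comp_apply]
  field_simp

lemma continuous_charFun (ν : Measure ℝ) [IsFiniteMeasure ν] : Continuous (charFun ν) := by
  have : charFun ν = fun t : ℝ => ∫ x, cexp (t * x * I) ∂ν := by
    ext t; rw [charFun_apply_real]
  rw [this]
  refine continuous_of_dominated (bound := fun _ => 1) ?_ ?_ (integrable_const _) ?_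
  · exact fun t => (by fun_prop : Continuous fun x : ℝ => cexp (t * x * I)).aestronglyMeasurable
  · refine fun t => .of_forall fun x => ?_
    rw [← ofReal_mul, norm_exp_ofReal_mul_I]
  · exact .of_forall fun x => by fun_prop

lemma tendsto_bohrMean_charFun_mul_cexp (ν : Measure ℝ) [IsFiniteMeasure ν] (w : ℝ) :
    Tendsto (fun T => bohrMean T fun t => charFun ν t * cexp (-(w * t * I))) atTop
      (𝓝 (ν.real {w} : ℝ)) := by
  have h := tendsto_bohrMean_charFun (ν.map (· + -w))
  have e : charFun (ν.map (· + -w)) = fun t => charFun ν t * cexp (-(w * t * I)) := by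
    ext t
    rw [charFun_map_add_const]
    congr 2
    simp [mul_comm]
  rw [e] at h
  rw [map_measureReal_apply (by fun_prop) (measurableSet_singleton _)] at h
  have hw : (fun x => x + -w) ⁻¹' {0} = {w} := by
    ext x
    simp
  rwa [hw] at h

lemma tendsto_bohrMean_norm_charFun (ν : Measure ℝ) [IsFiniteMeasure ν] [NullSingletonClass ν] :
    Tendsto (fun T => bohrMean T fun t => charFun ν t * (starRingEnd ℂ) (charFun ν t)) atTop
      (𝓝 0) := by
  have h := tendsto_bohrMean_charFun (ν ∗ ν.map ((-1) * ·))
  have e : charFun (ν ∗ ν.map ((-1) * ·)) =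
      fun t => charFun ν t * (starRingEnd ℂ) (charFun ν t) := by
    ext t
    rw [charFun_conv, charFun_map_mul, ← charFun_neg, neg_one_mul]
  have h0 : (ν ∗ ν.map ((-1) * ·)) {0} = 0 := by
    rw [Measure.conv, Measure.map_apply (by fun_prop) (measurableSet_singleton _),
      Measure.prod_apply (by measurability)]
    refine lintegral_eq_zero_of_ae_eq_zero (.of_forall fun x => ?_)
    have hx : MeasurableSet (Prod.mk x ⁻¹' ((fun p : ℝ × ℝ => p.1 + p.2) ⁻¹' {0})) := by
      rw [← preimage_comp]
      exact (by fun_prop : Measurable fun y : ℝ => x + y) (measurableSet_singleton _)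
    beta_reduce
    rw [Measure.map_apply (by fun_prop) hx]
    have : (fun y : ℝ => -1 * y) ⁻¹' (Prod.mk x ⁻¹' ((fun p : ℝ × ℝ => p.1 + p.2) ⁻¹' {0})) = {x} := by
      ext y
      simp only [mem_preimage, mem_singleton_iff]
      constructor <;> intro <;> linarith
    rw [this]; simp
  rw [e, Measure.real, h0] at h
  simpa using h

section AddCircle

variable {P : ℝ} [hP : Fact (0 < P)]

lemma fourierCoeff_comp_add (f : AddCircle P → ℂ) (a : AddCircle P) (n : ℤ) :
    fourierCoeff (fun u => f (u + a)) n = fourier n a * fourierCoeff f n := by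
  rw [fourierCoeff, fourierCoeff,
    ← integral_add_right_eq_self (fun u => fourier (-n) u • f u) a, ← integral_const_mul]
  congr 1
  ext u
  simp only [smul_eq_mul, fourier_apply, zsmul_add, neg_smul, AddCircle.toCircle_add,
    AddCircle.toCircle_neg, mul_inv, Circle.coe_mul]
  have : ((n • a).toCircle : ℂ) * (((n • a).toCircle)⁻¹ : Circle) = 1 := by
    rw [← Circle.coe_mul, mul_inv_cancel, Circle.coe_one]
  linear_combination (-((((n • u).toCircle)⁻¹ : Circle) : ℂ) * f (u + a)) * this

lemma hasSum_conj_fourierCoeff_mul {f₁ f₂ : AddCircle P → ℂ}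
    (h₁ : MemLp f₁ 2 (AddCircle.haarAddCircle (T := P)))
    (h₂ : MemLp f₂ 2 (AddCircle.haarAddCircle (T := P))) :
    HasSum (fun n => (starRingEnd ℂ) (fourierCoeff f₁ n) * fourierCoeff f₂ n)
      (∫ u, (starRingEnd ℂ) (f₁ u) * f₂ u ∂AddCircle.haarAddCircle) := by
  have h := (fourierBasis (T := P)).hasSum_inner_mul_inner h₁.toLp h₂.toLp
  have e : (∫ u, (starRingEnd ℂ) (f₁ u) * f₂ u ∂AddCircle.haarAddCircle) =
      inner ℂ h₁.toLp h₂.toLp := by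
    rw [L2.inner_def]
    refine integral_congr_ae ?_
    filter_upwards [h₁.coeFn_toLp, h₂.coeFn_toLp] with u hu₁ hu₂
    rw [hu₁, hu₂, RCLike.inner_apply']
  rw [e]
  refine h.congr_fun fun n => ?_
  rw [← fourierCoeff_congr_ae h₁.coeFn_toLp, ← fourierCoeff_congr_ae h₂.coeFn_toLp,
    ← fourierBasis_repr, ← fourierBasis_repr, HilbertBasis.repr_apply_apply,
    HilbertBasis.repr_apply_apply, inner_conj_symm]

/-- The autocorrelation of a square integrable function on a circle is the characteristic function
of a measure. -/
lemma exists_charFun_eq_autocorrelation {f : AddCircle P → ℂ}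
    (hf : MemLp f 2 (AddCircle.haarAddCircle (T := P))) :
    ∃ ν : Measure ℝ, IsFiniteMeasure ν ∧ ∀ t : ℝ, charFun ν t =
      ∫ u, (starRingEnd ℂ) (f u) * f (u + (t : AddCircle P)) ∂AddCircle.haarAddCircle := by
  have hshift : ∀ t : ℝ, MemLp (fun u => f (u + (t : AddCircle P))) 2
      (AddCircle.haarAddCircle (T := P)) := fun t =>
    hf.comp_measurePreserving (measurePreserving_add_right _ _)
  set c : ℤ → ℝ := fun n => ‖fourierCoeff f n‖ ^ 2
  have hc0 : ∀ n, 0 ≤ c n := fun n => by positivity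
  have hc : Summable c := by
    have := (hasSum_conj_fourierCoeff_mul hf hf).summable
    simp only [Complex.conj_mul'] at this
    exact_mod_cast this
  set ν : Measure ℝ := Measure.sum fun n : ℤ =>
    ENNReal.ofReal (c n) • Measure.dirac (2 * Real.pi * n / P)
  have hν : IsFiniteMeasure ν := ⟨by
    rw [Measure.sum_apply _ MeasurableSet.univ]
    simp only [Measure.smul_apply, measure_univ, smul_eq_mul, mul_one]
    rw [← ENNReal.ofReal_tsum_of_nonneg hc0 hc]
    exact ENNReal.ofReal_lt_top⟩
  refine ⟨ν, hν, fun t => ?_⟩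
  have h1 := hasSum_conj_fourierCoeff_mul hf (hshift t)
  have hint : Integrable (fun x : ℝ => cexp (t * x * I)) ν := by
    refine (integrable_const (1:ℝ)).mono (by fun_prop) (.of_forall fun x => ?_)
    rw [← ofReal_mul, norm_exp_ofReal_mul_I]; simp
  have h2 := hasSum_integral_measure hint
  rw [charFun_apply_real]
  refine h2.unique (h1.congr_fun fun n => ?_)
  rw [integral_smul_measure, integral_dirac, fourierCoeff_comp_add, fourier_coe_apply,
    ENNReal.toReal_ofReal (hc0 n), Complex.real_smul]
  have e : ((c n : ℝ) : ℂ) = (starRingEnd ℂ) (fourierCoeff f n) * fourierCoeff f n := by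
    rw [Complex.conj_mul']; push_cast [c]; rfl
  rw [e, show (t : ℂ) * ((2 * Real.pi * n / P : ℝ) : ℂ) * I = 2 * Real.pi * I * n * t / P by
    push_cast; ring]
  ring

end AddCircle

lemma exists_charFun_near_bohrMean {g : ℝ → ℂ} (hg : Continuous g) {C T : ℝ}
    (hC : ∀ x, ‖g x‖ ≤ C) (hT : 0 < T) :
    ∃ ν : Measure ℝ, IsFiniteMeasure ν ∧ ∀ t : ℝ,
      ‖charFun ν t - bohrMean T fun x => (starRingEnd ℂ) (g x) * g (x + t)‖ ≤ C ^ 2 * |t| / T := by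
  have hC0 : 0 ≤ C := (norm_nonneg _).trans (hC 0)
  have : Fact (0 < 2 * T) := ⟨by linarith⟩
  set f : AddCircle (2 * T) → ℂ := AddCircle.liftIoc (2 * T) (-T) g with hf
  have hfC : ∀ u, ‖f u‖ ≤ C := fun u => hC _
  have hfg : ∀ x ∈ Ioc (-T) T, f (x : ℝ) = g x := fun x hx =>
    AddCircle.liftIoc_coe_apply (by rwa [show -T + 2 * T = T by ring])
  have hLp' : MemLp f 2 :=
    (MemLp.of_bound (μ := volume.restrict (Ioc (-T) (-T + 2 * T))) (p := 2)
      hg.aestronglyMeasurable C (.of_forall hC)).memLp_liftIoc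
  have hLp : MemLp f 2 AddCircle.haarAddCircle := hLp'.haarAddCircle
  obtain ⟨ν, hν, h⟩ := exists_charFun_eq_autocorrelation hLp
  refine ⟨ν, hν, fun t => ?_⟩
  set φ : AddCircle (2 * T) → ℂ := fun u =>
    (starRingEnd ℂ) (f u) * f (u + (t : AddCircle (2 * T))) with hφ
  have hφi : IntervalIntegrable (fun x : ℝ => φ x) volume (-T) T := by
    rw [intervalIntegrable_iff_integrableOn_Ioc_of_le (by linarith)]
    have h1 : Integrable φ volume := by
      have : MemLp (fun u => f (u + (t : AddCircle (2 * T)))) 2 :=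
        hLp'.comp_measurePreserving (measurePreserving_add_right _ _)
      exact hLp'.star.integrable_mul this
    have := (AddCircle.measurePreserving_mk (2 * T) (-T)).integrable_comp_of_integrable h1
    rwa [show -T + 2 * T = T by ring] at this
  have e : charFun ν t = bohrMean T fun x => φ (x : ℝ) := by
    rw [h t, AddCircle.integral_haarAddCircle, ← AddCircle.intervalIntegral_preimage (2 * T) (-T),
      bohrMean, show -T + 2 * T = T by ring, Complex.real_smul]
    push_cast
    simp [hφ]
  have hcg : Continuous fun x => (starRingEnd ℂ) (g x) * g (x + t) := by fun_prop
  rw [e, bohrMean, bohrMean, ← mul_sub, ← intervalIntegral.integral_sub hφi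
    (hcg.intervalIntegrable _ _), norm_mul, norm_one_div_two_mul hT,
    intervalIntegral.integral_of_le (by linarith)]
  set S : Set ℝ := Ioc (-T) (-T - t) ∪ Ioc (T - t) T with hS
  have hSm : MeasurableSet S := measurableSet_Ioc.union measurableSet_Ioc
  have hSv : volume.real S ≤ |t| := by
    refine (measureReal_union_le _ _).trans ?_
    rw [Real.volume_real_Ioc, Real.volume_real_Ioc]
    rcases le_total 0 t with ht | ht
    · rw [max_eq_right (by linarith), max_eq_left (by linarith), abs_of_nonneg ht]; linarith
    · rw [max_eq_left (by linarith), max_eq_right (by linarith), abs_of_nonpos ht]; linarith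
  have hSf : volume S ≠ ∞ := (measure_union_lt_top measure_Ioc_lt_top measure_Ioc_lt_top).ne
  have hb : ‖∫ x in Ioc (-T) T, φ (x : ℝ) - (starRingEnd ℂ) (g x) * g (x + t)‖ ≤
      2 * C ^ 2 * |t| := by
    calc _ ≤ ∫ x in Ioc (-T) T, S.indicator (fun _ => 2 * C ^ 2) x := by
          refine norm_integral_le_of_norm_le ?_ ?_
          · exact ((integrable_const _).indicator hSm)
          · filter_upwards [ae_restrict_mem measurableSet_Ioc] with x hx
            by_cases hxS : x ∈ S
            · rw [indicator_of_mem hxS]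
              calc _ ≤ ‖φ (x : ℝ)‖ + ‖(starRingEnd ℂ) (g x) * g (x + t)‖ := norm_sub_le _ _
                _ ≤ C * C + C * C := by
                  simp only [hφ, norm_mul, RCLike.norm_conj]
                  gcongr <;> first | exact hfC _ | exact hC _
                _ = 2 * C ^ 2 := by ring
            · rw [indicator_of_notMem hxS]
              have hxt : x + t ∈ Ioc (-T) T := by
                simp only [hS, mem_union, mem_Ioc, not_or, not_and, not_le] at hxS
                refine ⟨?_, ?_⟩
                · linarith [hxS.1 hx.1]
                · by_contra hlt
                  linarith [hxS.2 (by linarith), hx.2]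
              simp only [hφ]
              rw [← AddCircle.coe_add, hfg _ hx, hfg _ hxt]
              simp
      _ ≤ ∫ x, S.indicator (fun _ => 2 * C ^ 2) x := by
          refine setIntegral_le_integral ?_ (.of_forall fun x => indicator_nonneg (fun _ _ => by positivity) _)
          exact (integrable_indicator_iff hSm).2 (integrableOn_const hSf)
      _ = volume.real S * (2 * C ^ 2) := by
          rw [integral_indicator_const _ hSm, smul_eq_mul]
      _ ≤ 2 * C ^ 2 * |t| := by nlinarith [sq_nonneg C]
  calc _ ≤ 1 / (2 * T) * (2 * C ^ 2 * |t|) := by gcongr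
    _ = _ := by field_simp

/-- Lévy's continuity theorem, in the form producing the limit measure. -/
lemma exists_charFun_eq_of_tendsto {μ : ℕ → Measure ℝ} [∀ n, IsProbabilityMeasure (μ n)]
    {φ : ℝ → ℂ} (hφ : ContinuousAt φ 0)
    (h : ∀ t, Tendsto (fun n => charFun (μ n) t) atTop (𝓝 (φ t))) :
    ∃ ν : Measure ℝ, IsProbabilityMeasure ν ∧ charFun ν = φ := by
  have ht := isTightMeasureSet_of_tendsto_charFun hφ h
  let p : ℕ → ProbabilityMeasure ℝ := fun n => ⟨μ n, inferInstance⟩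
  have hK : IsCompact (closure (range p)) := isCompact_closure_of_isTightMeasureSet (by
    convert ht using 1
    ext m
    constructor
    · rintro ⟨-, ⟨n, rfl⟩, rfl⟩
      exact ⟨n, rfl⟩
    · rintro ⟨n, rfl⟩
      exact ⟨p n, ⟨n, rfl⟩, rfl⟩)
  let U : Ultrafilter ℕ := Ultrafilter.of atTop
  obtain ⟨ν, -, hν⟩ := hK.ultrafilter_le_nhds (U.map p)
    (le_principal_iff.2 (mem_map.2 (Filter.univ_mem' fun n => subset_closure (mem_range_self n))))
  have hν' : Tendsto p U (𝓝 ν) := hν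
  rw [ProbabilityMeasure.tendsto_iff_forall_integral_rclike_tendsto ℂ] at hν'
  refine ⟨ν, inferInstance, funext fun t => ?_⟩
  have h1 := hν' (BoundedContinuousFunction.innerProbChar t)
  simp only [← charFun_eq_integral_innerProbChar] at h1
  exact tendsto_nhds_unique h1 ((h t).mono_left (Ultrafilter.of_le _))

lemma charFun_smul_measure (ν : Measure ℝ) (c : ℝ≥0∞) (t : ℝ) :
    charFun (c • ν) t = c.toReal * charFun ν t := by
  rw [charFun_apply, charFun_apply, integral_smul_measure, Complex.real_smul]

lemma exists_charFun_eq_of_tendsto_of_isFiniteMeasure {ν : ℕ → Measure ℝ}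
    [∀ n, IsFiniteMeasure (ν n)] {φ : ℝ → ℂ} (hφ : ContinuousAt φ 0)
    (h : ∀ t, Tendsto (fun n => charFun (ν n) t) atTop (𝓝 (φ t))) :
    ∃ μ : Measure ℝ, IsFiniteMeasure μ ∧ charFun μ = φ := by
  have hm : Tendsto (fun n => (((ν n).real univ : ℝ) : ℂ)) atTop (𝓝 (φ 0)) := by
    simpa only [charFun_zero] using h 0
  have hre : Tendsto (fun n => (ν n).real univ) atTop (𝓝 (φ 0).re) := by
    exact (Complex.continuous_re.tendsto _).comp hm
  have hφ0 : (((φ 0).re : ℝ) : ℂ) = φ 0 :=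
    tendsto_nhds_unique ((Complex.continuous_ofReal.tendsto _).comp hre) hm
  by_cases h0 : φ 0 = 0
  · refine ⟨0, inferInstance, funext fun t => ?_⟩
    rw [charFun_zero_measure]
    rw [h0, zero_re] at hre
    exact tendsto_nhds_unique (squeeze_zero_norm (fun n => norm_charFun_le t) hre) (h t)
  classical
  let μ : ℕ → Measure ℝ := fun n =>
    if ν n = 0 then Measure.dirac 0 else ((ν n) univ)⁻¹ • ν n
  have hμ : ∀ n, IsProbabilityMeasure (μ n) := fun n => by
    by_cases hn : ν n = 0
    · simp only [μ, hn, if_true]; infer_instance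
    · simp only [μ, hn, if_false]
      have : NeZero (ν n) := ⟨hn⟩
      infer_instance
  have hev : ∀ᶠ n in atTop, ν n ≠ 0 := by
    filter_upwards [hm.eventually_ne h0] with n hn h
    simp [h] at hn
  have hlim : ∀ t, Tendsto (fun n => charFun (μ n) t) atTop (𝓝 ((φ 0)⁻¹ * φ t)) := fun t => by
    refine ((hm.inv₀ h0).mul (h t)).congr' ?_
    filter_upwards [hev] with n hn
    simp only [μ, hn, if_false]
    rw [charFun_smul_measure, ENNReal.toReal_inv]
    push_cast
    rfl
  obtain ⟨ρ, hρ, e⟩ := exists_charFun_eq_of_tendsto (φ := fun t => (φ 0)⁻¹ * φ t)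
    (continuousAt_const.mul hφ) hlim
  have hpos : 0 ≤ (φ 0).re := ge_of_tendsto' hre fun n => measureReal_nonneg
  refine ⟨ENNReal.ofReal (φ 0).re • ρ, Measure.smul_finite _ ENNReal.ofReal_ne_top,
    funext fun t => ?_⟩
  rw [charFun_smul_measure, e, ENNReal.toReal_ofReal hpos, hφ0]
  exact mul_inv_cancel_left₀ h0 _

lemma TranslatesTotallyBounded.norm_autocorrelation_sub_le {g φ : ℝ → ℂ}
    (hg : TranslatesTotallyBounded g)
    (hφ : ∀ t, Tendsto (fun T => bohrMean T fun x => (starRingEnd ℂ) (g x) * g (x + t)) atTop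
      (𝓝 (φ t))) {C : ℝ} (hC : ∀ x, ‖g x‖ ≤ C) {s t ε : ℝ}
    (h : ∀ x, ‖g (x + t) - g (x + s)‖ ≤ ε) : ‖φ t - φ s‖ ≤ C * ε := by
  have hc := hg.cont
  refine le_of_tendsto ((hφ t).sub (hφ s)).norm ?_
  filter_upwards [eventually_gt_atTop 0] with T hT
  refine norm_bohrMean_sub_le (by fun_prop) (by fun_prop) hT fun x => ?_
  rw [← mul_sub, norm_mul, RCLike.norm_conj]
  exact mul_le_mul (hC x) (h x) (norm_nonneg _) ((norm_nonneg _).trans (hC x))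

/-- The autocorrelation of an almost periodic function is the characteristic function of a finite
measure. -/
lemma APR.exists_charFun_eq_autocorrelation {g : ℝ → ℂ} (hg : APR g) :
    ∃ μ : Measure ℝ, IsFiniteMeasure μ ∧ ∀ t, Tendsto
      (fun T => bohrMean T fun x => (starRingEnd ℂ) (g x) * g (x + t)) atTop
      (𝓝 (charFun μ t)) := by
  have hT := hg.translatesTotallyBounded
  obtain ⟨C, hC⟩ := hT.bdd
  have hC0 : 0 ≤ C := (norm_nonneg _).trans (hC 0)
  set φ : ℝ → ℂ := fun t => (hT.conj.mul (hT.translate t)).meanValue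
  have hφ : ∀ t, Tendsto (fun T => bohrMean T fun x => (starRingEnd ℂ) (g x) * g (x + t)) atTop
      (𝓝 (φ t)) := fun t => (hT.conj.mul (hT.translate t)).tendsto_bohrMean
  choose ν hν hνb using fun n : ℕ =>
    exists_charFun_near_bohrMean hg.1 hC (T := (n : ℝ) + 1) (by positivity)
  have hn : Tendsto (fun n : ℕ => (n : ℝ) + 1) atTop atTop :=
    tendsto_atTop_add_const_right _ _ tendsto_natCast_atTop_atTop
  have hlim : ∀ t, Tendsto (fun n => charFun (ν n) t) atTop (𝓝 (φ t)) := fun t => by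
    have h1 := squeeze_zero_norm (fun n => hνb n t)
      ((tendsto_const_nhds (x := C ^ 2 * |t|)).div_atTop hn)
    simpa using h1.add ((hφ t).comp hn)
  have hcont : ContinuousAt φ 0 := by
    rw [Metric.continuousAt_iff]
    intro ε hε
    obtain ⟨δ, hδ, h⟩ := hg.uniform_delta (show 0 < ε / (C + 1) by positivity)
    refine ⟨δ, hδ, fun {t} ht => ?_⟩
    rw [Real.dist_eq, sub_zero] at ht
    rw [dist_eq_norm]
    calc ‖φ t - φ 0‖ ≤ C * (ε / (C + 1)) :=
          hT.norm_autocorrelation_sub_le hφ hC fun x => h _ _ (by simpa using ht)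
      _ < ε := by rw [mul_div, div_lt_iff₀ (by positivity)]; nlinarith
  obtain ⟨μ, hμ, e⟩ := exists_charFun_eq_of_tendsto_of_isFiniteMeasure hcont hlim
  exact ⟨μ, hμ, fun t => by rw [e]; exact hφ t⟩

/-- If the autocorrelation means of `k` converge, then the mean of the autocorrelation is the
squared modulus of the mean. -/
lemma TranslatesTotallyBounded.tendsto_bohrMean_autocorrelation {k φ : ℝ → ℂ}
    (hk : TranslatesTotallyBounded k)
    (hφ : ∀ t, Tendsto (fun T => bohrMean T fun x => (starRingEnd ℂ) (k x) * k (x + t)) atTop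
      (𝓝 (φ t))) :
    Tendsto (fun T => bohrMean T φ) atTop (𝓝 ((starRingEnd ℂ) hk.meanValue * hk.meanValue)) := by
  set b := hk.meanValue with hb
  obtain ⟨C, hC⟩ := hk.bdd
  have hC0 : 0 ≤ C := (norm_nonneg _).trans (hC 0)
  have hkc := hk.cont
  rw [Metric.tendsto_atTop]
  intro ε hε
  obtain ⟨T₀, hT₀, h⟩ := hk.uniform_bohrMean (show 0 < ε / (C + 1) by positivity)
  refine ⟨T₀, fun T hT => ?_⟩
  have hT0 : 0 < T := hT₀.trans_le hT
  have hF : Continuous (Function.uncurry fun x t : ℝ => (starRingEnd ℂ) (k x) * k (x + t)) := by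
    simp only [Function.uncurry_def]; fun_prop
  have hlim : Tendsto (fun X => bohrMean T fun t => bohrMean X fun x =>
      (starRingEnd ℂ) (k x) * k (x + t)) atTop (𝓝 (bohrMean T φ)) := by
    refine Tendsto.const_mul _ (intervalIntegral.tendsto_integral_filter_of_dominated_convergence
      (fun _ => C * C) ?_ ?_ (by simp) ?_)
    · refine .of_forall fun X => Continuous.aestronglyMeasurable ?_
      refine continuous_const.mul ?_
      exact intervalIntegral.continuous_parametric_intervalIntegral_of_continuous'
        (f := fun t x => (starRingEnd ℂ) (k x) * k (x + t))
        (hF.comp continuous_swap) _ _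
    · filter_upwards [eventually_gt_atTop 0] with X hX
      refine .of_forall fun t _ => norm_bohrMean_le hX fun x => ?_
      rw [norm_mul, RCLike.norm_conj]
      exact mul_le_mul (hC _) (hC _) (norm_nonneg _) hC0
    · exact .of_forall fun t _ => hφ t
  have hlim' : Tendsto (fun X => bohrMean X fun x => (starRingEnd ℂ) (k x) * b) atTop
      (𝓝 ((starRingEnd ℂ) b * b)) := by
    simp only [bohrMean_mul_const, bohrMean_conj]
    exact ((continuous_conj.tendsto _).comp hk.tendsto_bohrMean).mul_const b
  have hle : ‖bohrMean T φ - (starRingEnd ℂ) b * b‖ ≤ C * (ε / (C + 1)) := by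
    refine le_of_tendsto (hlim.sub hlim').norm ?_
    filter_upwards [eventually_gt_atTop 0] with X hX
    rw [← bohrMean_comm hF]
    have hc : Continuous fun x => bohrMean T fun t => (starRingEnd ℂ) (k x) * k (x + t) :=
      continuous_const.mul (intervalIntegral.continuous_parametric_intervalIntegral_of_continuous'
        (f := fun x t => (starRingEnd ℂ) (k x) * k (x + t)) hF _ _)
    refine norm_bohrMean_sub_le hc (by fun_prop) hX fun x => ?_
    rw [bohrMean_const_mul, ← mul_sub, norm_mul, RCLike.norm_conj]
    have := h T hT x
    simp only [add_comm _ x] at this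
    exact mul_le_mul (hC x) this (norm_nonneg _) hC0
  rw [dist_eq_norm]
  refine hle.trans_lt ?_
  rw [mul_div, div_lt_iff₀ (by positivity)]
  nlinarith

lemma norm_cexp_sub_sq (a b : ℝ) :
    ‖cexp (a * I) - cexp (b * I)‖ ^ 2 = 2 - 2 * (cexp (((a - b : ℝ) : ℂ) * I)).re := by
  rw [← Complex.normSq_eq_norm_sq, Complex.normSq_apply]
  simp only [sub_re, sub_im, exp_ofReal_mul_I_re, exp_ofReal_mul_I_im, Real.cos_sub]
  nlinarith [Real.sin_sq_add_cos_sq a, Real.sin_sq_add_cos_sq b]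

/-- Translates of the characteristic function of a restricted measure are controlled by the
characteristic function of the whole measure near its maximum. -/
lemma norm_charFun_restrict_sub_le (μ : Measure ℝ) [IsFiniteMeasure μ] (A : Set ℝ) {η : ℝ}
    (hη : 0 < η) (x s t : ℝ) :
    ‖charFun (μ.restrict A) (x + t) - charFun (μ.restrict A) (x + s)‖ ≤
      η * μ.real univ + (1 / (2 * η)) * ‖charFun μ 0 - charFun μ (t - s)‖ := by
  have hi : ∀ (ν : Measure ℝ) [IsFiniteMeasure ν] (t : ℝ),
      Integrable (fun ξ : ℝ => cexp ((t * ξ : ℝ) * I)) ν := fun ν _ t =>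
    (integrable_const (1:ℝ)).mono (by fun_prop) (.of_forall fun x => by
      rw [norm_exp_ofReal_mul_I]; simp)
  have hch : ∀ (ν : Measure ℝ) (t : ℝ), charFun ν t = ∫ ξ, cexp ((t * ξ : ℝ) * I) ∂ν :=
    fun ν t => by simp [charFun_apply_real]
  have hre : ∫ ξ, (cexp (((t - s) * ξ : ℝ) * I)).re ∂μ = (charFun μ (t - s)).re := by
    rw [hch]; exact integral_re (hi μ (t - s))
  have hn : Integrable (fun ξ : ℝ => ‖cexp ((t * ξ : ℝ) * I) - cexp ((s * ξ : ℝ) * I)‖) μ :=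
    ((hi μ t).sub (hi μ s)).norm
  have hr : Integrable (fun ξ : ℝ => (cexp (((t - s) * ξ : ℝ) * I)).re) μ := (hi μ (t - s)).re
  have hr' : Integrable (fun ξ : ℝ => 1 / (2 * η) * (1 - (cexp (((t - s) * ξ : ℝ) * I)).re)) μ :=
    ((integrable_const (1:ℝ)).sub hr).const_mul _
  have hb : Integrable (fun ξ : ℝ => η + 1 / (2 * η) * (1 - (cexp (((t - s) * ξ : ℝ) * I)).re)) μ :=
    (integrable_const η).add hr'
  calc _ ≤ ∫ ξ, ‖cexp ((t * ξ : ℝ) * I) - cexp ((s * ξ : ℝ) * I)‖ ∂(μ.restrict A) := by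
        rw [hch, hch, ← integral_sub (hi _ _) (hi _ _)]
        refine (norm_integral_le_integral_norm _).trans_eq (integral_congr_ae (.of_forall fun ξ => ?_))
        beta_reduce
        rw [add_mul, add_mul, ofReal_add, ofReal_add, add_mul, add_mul, Complex.exp_add,
          Complex.exp_add, ← mul_sub, norm_mul, norm_exp_ofReal_mul_I, one_mul]
    _ ≤ ∫ ξ, ‖cexp ((t * ξ : ℝ) * I) - cexp ((s * ξ : ℝ) * I)‖ ∂μ :=
        setIntegral_le_integral hn (.of_forall fun _ => norm_nonneg _)
    _ ≤ ∫ ξ, (η + 1 / (2 * η) * (1 - (cexp (((t - s) * ξ : ℝ) * I)).re)) ∂μ := by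
        refine integral_mono hn hb fun ξ => ?_
        have h1 := norm_cexp_sub_sq (t * ξ) (s * ξ)
        rw [← sub_mul] at h1
        beta_reduce
        set a := ‖cexp ((t * ξ : ℝ) * I) - cexp ((s * ξ : ℝ) * I)‖
        have h2 : 1 - (cexp (((t - s) * ξ : ℝ) * I)).re = a ^ 2 / 2 := by rw [h1]; ring
        rw [h2, ← sub_nonneg]
        have : η + 1 / (2 * η) * (a ^ 2 / 2) - a = (2 * η - a) ^ 2 / (4 * η) := by
          field_simp; ring
        rw [this]; positivity
    _ = η * μ.real univ + (1 / (2 * η)) * (charFun μ 0 - charFun μ (t - s)).re := by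
        rw [integral_add (integrable_const _) hr', integral_const_mul,
          integral_sub (integrable_const _) hr, hre]
        simp [mul_comm]
    _ ≤ _ := by gcongr; exact Complex.re_le_norm _

/-- A finite measure whose characteristic function is the autocorrelation of an almost periodic
function is purely atomic. -/
lemma TranslatesTotallyBounded.measure_compl_atoms {g : ℝ → ℂ} (hg : TranslatesTotallyBounded g)
    {μ : Measure ℝ} [IsFiniteMeasure μ]
    (hφ : ∀ t, Tendsto (fun T => bohrMean T fun x => (starRingEnd ℂ) (g x) * g (x + t)) atTop
      (𝓝 (charFun μ t))) {A : Set ℝ} (h0 : ∀ x ∉ A, μ {x} = 0) :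
    μ Aᶜ = 0 := by
  have : NullSingletonClass (μ.restrict Aᶜ) := ⟨fun x => by
    rw [Measure.restrict_apply (measurableSet_singleton x)]
    by_cases hx : x ∈ A
    · rw [singleton_inter_eq_empty.2 (by simpa using hx), measure_empty]
    · exact measure_mono_null inter_subset_left (h0 x hx)⟩
  obtain ⟨C, hC⟩ := hg.bdd
  have hC0 : 0 ≤ C := (norm_nonneg _).trans (hC 0)
  have hM : 0 ≤ μ.real univ := measureReal_nonneg
  have hT : TranslatesTotallyBounded (charFun (μ.restrict Aᶜ)) := by
    refine ⟨continuous_charFun _, ⟨_, fun t => norm_charFun_le t⟩, fun ε hε => ?_⟩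
    set η := ε / (2 * (μ.real univ + 1)) with hη
    have hη0 : 0 < η := by positivity
    obtain ⟨F, hF⟩ := hg.net (ε * η / (C + 1)) (by positivity)
    refine ⟨F, fun t => ?_⟩
    obtain ⟨s, hs, h⟩ := hF t
    refine ⟨s, hs, fun x => (norm_charFun_restrict_sub_le μ _ hη0 x s t).trans ?_⟩
    have h1 : ‖charFun μ 0 - charFun μ (t - s)‖ ≤ C * (ε * η / (C + 1)) := by
      refine hg.norm_autocorrelation_sub_le hφ hC fun x => ?_
      rw [norm_sub_rev]
      rw [show x + (t - s) = x - s + t by ring, show x + 0 = x - s + s by ring]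
      exact h _
    have h2 : η * μ.real univ ≤ ε / 2 := by
      rw [hη, div_mul_eq_mul_div, div_le_div_iff₀ (by positivity) two_pos]
      nlinarith
    have h3 : C * (ε * η / (C + 1)) ≤ ε * η := by
      rw [mul_div, div_le_iff₀ (by positivity)]
      nlinarith [mul_pos hε hη0]
    calc _ ≤ ε / 2 + 1 / (2 * η) * (ε * η) := by gcongr; exact h1.trans h3
      _ = ε := by field_simp; ring
  have h := hT.eq_zero_of_tendsto (tendsto_bohrMean_norm_charFun _) 0
  rw [charFun_zero, ofReal_eq_zero, measureReal_restrict_apply_univ, measureReal_eq_zero_iff] at h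
  exact h

lemma TranslatesTotallyBounded.hasSum_measureReal_singleton {g : ℝ → ℂ}
    (hg : TranslatesTotallyBounded g) {μ : Measure ℝ} [IsFiniteMeasure μ]
    (hφ : ∀ t, Tendsto (fun T => bohrMean T fun x => (starRingEnd ℂ) (g x) * g (x + t)) atTop
      (𝓝 (charFun μ t))) : HasSum (fun w : ℝ => μ.real {w}) (μ.real univ) := by
  set A : Set ℝ := {x | 0 < μ {x}} with hAdef
  have hA : A.Countable := Measure.countable_meas_pos_of_disjoint_iUnion
    (fun x => measurableSet_singleton x) fun x y hxy => disjoint_singleton.2 hxy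
  have h0 := hg.measure_compl_atoms (A := A) hφ fun x hx => by
    simpa [hAdef] using hx
  have hsupp : Function.support (fun w : ℝ => μ.real {w}) ⊆ A := fun w hw => by
    rw [Function.mem_support, Ne, measureReal_eq_zero_iff] at hw
    exact pos_iff_ne_zero.2 hw
  rw [← hasSum_subtype_iff_of_support_subset hsupp]
  have hsum : ∑' w : A, μ {(w : ℝ)} = μ univ := by
    rw [← measure_add_measure_compl hA.measurableSet, h0, add_zero]
    conv_rhs => rw [← biUnion_of_singleton A]
    exact (measure_biUnion hA (fun x _ y _ hxy => disjoint_singleton.2 hxy)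
      fun x _ => measurableSet_singleton x).symm
  rw [Measure.real, ← hsum, ENNReal.tsum_toReal_eq fun w => measure_ne_top μ _]
  exact ENNReal.hasSum_toReal (by rw [hsum]; exact measure_ne_top μ _)

/-- The Fourier–Bohr coefficient of an almost periodic function, at angular frequency `w`. -/
def APR.coeff {g : ℝ → ℂ} (hg : APR g) (w : ℝ) : ℂ :=
  (hg.translatesTotallyBounded.mul (apr_cexp w).translatesTotallyBounded).meanValue

lemma APR.tendsto_coeff {g : ℝ → ℂ} (hg : APR g) (w : ℝ) :
    Tendsto (fun T => bohrMean T fun x => g x * cexp (-(w * x * I))) atTop (𝓝 (hg.coeff w)) :=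
  (hg.translatesTotallyBounded.mul (apr_cexp w).translatesTotallyBounded).tendsto_bohrMean

/-- **Parseval's identity** for almost periodic functions. -/
theorem APR.hasSum_sq_norm_coeff {g : ℝ → ℂ} (hg : APR g) :
    ∃ L : ℝ, HasSum (fun w => ‖hg.coeff w‖ ^ 2) L ∧
      Tendsto (fun T : ℝ => (1 / (2 * T)) * ∫ x in (-T)..T, ‖g x‖ ^ 2) atTop (𝓝 L) := by
  obtain ⟨μ, hμ, hφ⟩ := hg.exists_charFun_eq_autocorrelation
  refine ⟨μ.real univ, ?_, ?_⟩
  · convert hg.translatesTotallyBounded.hasSum_measureReal_singleton hφ using 2 with w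
    have hk := hg.translatesTotallyBounded.mul (apr_cexp w).translatesTotallyBounded
    have h := hk.tendsto_bohrMean_autocorrelation
      (φ := fun t => charFun μ t * cexp (-(w * t * I))) fun t => by
        convert (hφ t).mul_const (cexp (-(w * t * I))) using 2 with T
        rw [← bohrMean_mul_const]
        congr 1
        ext x
        have : (starRingEnd ℂ) (cexp (-(w * x * I))) * cexp (-(w * ((x + t : ℝ) : ℂ) * I)) =
            cexp (-(w * t * I)) := by
          rw [← Complex.exp_conj, ← Complex.exp_add]
          congr 1
          simp
          ring
        rw [← this, map_mul]
        ring
    have e := tendsto_nhds_unique h (tendsto_bohrMean_charFun_mul_cexp μ w)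
    rw [Complex.conj_mul'] at e
    exact (by exact_mod_cast e : ‖hk.meanValue‖ ^ 2 = μ.real {w})
  · have h := (Complex.continuous_re.tendsto _).comp (hφ 0)
    rw [charFun_zero, ofReal_re] at h
    refine h.congr fun T => ?_
    simp only [Function.comp_apply, add_zero, Complex.conj_mul']
    rw [← ofReal_re (1 / (2 * T) * ∫ x in (-T)..T, ‖g x‖ ^ 2), ← bohrMean_ofReal]
    push_cast
    rfl

/-- Means of a bounded holomorphic function over two horizontal lines agree asymptotically. -/
lemma tendsto_bohrMean_line_sub {F : ℂ → ℂ} {a b K : ℝ} (ha : 0 < a) (hb : 0 < b)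
    (hF : DifferentiableOn ℂ F UHP) (hK : ∀ z : ℂ, z.im ∈ uIcc a b → ‖F z‖ ≤ K) :
    Tendsto (fun T => bohrMean T (fun x => F (x + a * I)) - bohrMean T fun x => F (x + b * I))
      atTop (𝓝 0) := by
  refine squeeze_zero_norm' (a := fun T : ℝ => K * |b - a| / T) ?_
    (tendsto_const_nhds.div_atTop tendsto_id)
  filter_upwards [eventually_gt_atTop 0] with T hT
  have h := Complex.integral_boundary_rect_eq_zero_of_differentiableOn F
    ((-T : ℝ) + a * I) ((T : ℝ) + b * I) (hF.mono fun z hz => by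
      have h1 := hz.2
      simp only [mem_preimage, add_im, ofReal_im, mul_im, ofReal_re, I_im, mul_one, I_re,
        mul_zero, add_zero, zero_add] at h1
      exact (lt_min ha hb).trans_le h1.1)
  simp only [add_re, add_im, ofReal_re, ofReal_im, mul_re, mul_im, I_re, I_im, mul_zero, mul_one,
    add_zero, zero_add, sub_self, smul_eq_mul] at h
  have hv : ∀ c : ℝ, ‖∫ y in a..b, F (c + y * I)‖ ≤ K * |b - a| := fun c =>
    intervalIntegral.norm_integral_le_of_norm_le_const fun y hy => hK _ (by
      simpa using uIoc_subset_uIcc hy)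
  have e : (∫ x in (-T)..T, F (x + a * I)) - ∫ x in (-T)..T, F (x + b * I) =
      I * (∫ y in a..b, F ((-T : ℝ) + y * I)) - I * ∫ y in a..b, F (T + y * I) := by
    linear_combination h
  rw [bohrMean, bohrMean, ← mul_sub, e, ← mul_sub, norm_mul, norm_mul, norm_I, one_mul,
    norm_one_div_two_mul hT]
  calc _ ≤ 1 / (2 * T) * (K * |b - a| + K * |b - a|) := by
        gcongr; exact (norm_sub_le _ _).trans (add_le_add (hv _) (hv _))
    _ = _ := by field_simp; ring

lemma hasMeanAt_iff (f : ℂ → ℂ) (y lam : ℝ) (c : ℂ) :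
    HasMeanAt f y lam c ↔ Tendsto (fun T => bohrMean T fun x =>
      f ((x : ℂ) + (y : ℂ) * I) *
        cexp (-(2 * (Real.pi : ℂ) * I * (lam : ℂ) * ((x : ℂ) + (y : ℂ) * I)))) atTop (𝓝 c) :=
  Iff.rfl

lemma HasMeanAt.of_height {f : ℂ → ℂ} (hol : DifferentiableOn ℂ f UHP) (hb : BddOnStrips f)
    {a b lam : ℝ} {c : ℂ} (ha : 0 < a) (hb' : 0 < b) (h : HasMeanAt f a lam c) :
    HasMeanAt f b lam c := by
  obtain ⟨C, hC⟩ := hb.exists_bound (q := max a b) (lt_min ha hb')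
  have hF : DifferentiableOn ℂ (fun z => f z * cexp (-(2 * (Real.pi : ℂ) * I * (lam : ℂ) * z))) UHP :=
    hol.mul (by fun_prop)
  have := tendsto_bohrMean_line_sub (K := C * Real.exp (2 * Real.pi * |lam| * max a b)) ha hb' hF
    fun z hz => by
      have hz' : min a b ≤ z.im ∧ z.im ≤ max a b := hz
      have h0 : 0 < z.im := (lt_min ha hb').trans_le hz'.1
      rw [norm_mul, Complex.norm_exp]
      gcongr
      · exact (norm_nonneg _).trans (hC z hz)
      · exact hC z hz
      · have e : (-(2 * (Real.pi : ℂ) * I * (lam : ℂ) * z)).re = 2 * Real.pi * lam * z.im := by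
          simp
        rw [e]
        have := Real.pi_pos
        gcongr
        · exact le_abs_self _
        · exact hz'.2
  rw [hasMeanAt_iff] at h ⊢
  simpa using h.sub this

lemma APR.hasMeanAt {f : ℂ → ℂ} {y : ℝ} (hg : APR fun x : ℝ => f ((x : ℂ) + (y : ℂ) * I))
    (lam : ℝ) :
    HasMeanAt f y lam (hg.coeff (2 * Real.pi * lam) * Real.exp (2 * Real.pi * lam * y)) := by
  rw [hasMeanAt_iff]
  refine ((hg.tendsto_coeff (2 * Real.pi * lam)).mul_const _).congr fun T => ?_
  rw [← bohrMean_mul_const]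
  congr 1
  ext x
  rw [mul_assoc, ofReal_exp, ← Complex.exp_add]
  congr 2
  push_cast
  linear_combination (2 * (Real.pi : ℂ) * lam * y) * I_sq

/-- Existence and height-independence of the means, with Parseval's identity on horizontal
lines. -/
theorem APH.exists_hasMeanAt_parseval {f : ℂ → ℂ} (hf : APH f) : ∃ m : ℝ → ℂ,
    (∀ (lam : ℝ), ∀ y > (0:ℝ), HasMeanAt f y lam (m lam)) ∧
    {lam : ℝ | m lam ≠ 0}.Countable ∧
    ∀ y > (0:ℝ),
      Summable (fun lam : ℝ => ‖m lam‖ ^ 2 * Real.exp (-(4 * Real.pi * y * lam))) ∧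
      Tendsto (fun T : ℝ => (1 / (2 * T)) *
          ∫ x in (-T)..T, ‖f ((x : ℂ) + (y : ℂ) * I)‖ ^ 2) atTop
        (𝓝 (∑' lam : ℝ, ‖m lam‖ ^ 2 * Real.exp (-(4 * Real.pi * y * lam)))) := by
  have hg := fun (y : ℝ) (hy : 0 < y) => hf.apr_line hy
  set m : ℝ → ℂ := fun lam =>
    (hg 1 one_pos).coeff (2 * Real.pi * lam) * Real.exp (2 * Real.pi * lam * 1)
  have hm : ∀ (lam : ℝ), ∀ y > (0:ℝ), HasMeanAt f y lam (m lam) := fun lam y hy =>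
    ((hg 1 one_pos).hasMeanAt lam).of_height hf.1 hf.bddOnStrips one_pos hy
  have hterm : ∀ (y : ℝ) (hy : 0 < y) (lam : ℝ),
      ‖(hg y hy).coeff (2 * Real.pi * lam)‖ ^ 2 =
        ‖m lam‖ ^ 2 * Real.exp (-(4 * Real.pi * y * lam)) := fun y hy lam => by
    rw [tendsto_nhds_unique (hm lam y hy) ((hg y hy).hasMeanAt lam), norm_mul, norm_real,
      Real.norm_of_nonneg (Real.exp_nonneg _), mul_pow, ← Real.exp_nat_mul,
      show -(4 * Real.pi * y * lam) = -((2 : ℕ) * (2 * Real.pi * lam * y)) by push_cast; ring,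
      Real.exp_neg, mul_inv_cancel_right₀ (Real.exp_ne_zero _)]
  have hsum : ∀ y > (0:ℝ), ∃ L : ℝ,
      HasSum (fun lam => ‖m lam‖ ^ 2 * Real.exp (-(4 * Real.pi * y * lam))) L ∧
      Tendsto (fun T : ℝ => (1 / (2 * T)) * ∫ x in (-T)..T, ‖f ((x : ℂ) + (y : ℂ) * I)‖ ^ 2)
        atTop (𝓝 L) := fun y hy => by
    obtain ⟨L, hL, h⟩ := (hg y hy).hasSum_sq_norm_coeff
    refine ⟨L, ?_, h⟩
    simp only [← hterm y hy]
    exact (Equiv.mulLeft₀ (2 * Real.pi) (by positivity)).hasSum_iff.2 hL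
  refine ⟨m, hm, ?_, fun y hy => ?_⟩
  · obtain ⟨L, hL, -⟩ := hsum 1 one_pos
    refine hL.summable.countable_support.mono fun lam hlam => ?_
    exact mul_ne_zero (pow_ne_zero _ (norm_ne_zero_iff.2 hlam)) (Real.exp_ne_zero _)
  · obtain ⟨L, hL, h⟩ := hsum y hy
    exact ⟨hL.summable, by rwa [hL.tsum_eq]⟩

/-- Lemma 5.1: characterizations of holomorphic almost periodicity on the upper half-plane,
existence and height-independence of means, and the Parseval identity on horizontal lines. -/
theorem stmt14 (f : ℂ → ℂ) (hol : DifferentiableOn ℂ f UHP) :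
    ((BddOnStrips f ∧ ∀ h > (0:ℝ), APR fun x : ℝ => f ((x : ℂ) + (h : ℂ) * Complex.I)) ↔
      APH f) ∧
    ((BddOnStrips f ∧ ∃ h > (0:ℝ), APR fun x : ℝ => f ((x : ℂ) + (h : ℂ) * Complex.I)) ↔
      APH f) ∧
    (APH f → ∃ m : ℝ → ℂ,
      (∀ (lam : ℝ), ∀ y > (0:ℝ), HasMeanAt f y lam (m lam)) ∧
      {lam : ℝ | m lam ≠ 0}.Countable ∧
      ∀ y > (0:ℝ),
        Summable (fun lam : ℝ => ‖m lam‖ ^ 2 * Real.exp (-(4 * Real.pi * y * lam))) ∧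
        Tendsto (fun T : ℝ => (1 / (2 * T)) *
            ∫ x in (-T)..T, ‖f ((x : ℂ) + (y : ℂ) * Complex.I)‖ ^ 2) atTop
          (𝓝 (∑' lam : ℝ, ‖m lam‖ ^ 2 * Real.exp (-(4 * Real.pi * y * lam))))) := by
  refine ⟨⟨fun h => aph_of_apr_line hol h.1 one_pos (h.2 1 one_pos),
    fun h => ⟨h.bddOnStrips, fun _ hh => h.apr_line hh⟩⟩,
    ⟨fun ⟨hb, _, hh, h⟩ => aph_of_apr_line hol hb hh h,
    fun h => ⟨h.bddOnStrips, 1, one_pos, h.apr_line one_pos⟩⟩,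
    fun h => h.exists_hasMeanAt_parseval⟩
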